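/- Over an algebraically closed field k of characteristic ≠ 2,3,5, the null cone N_6 of binary sextics equals the common zero set of I_2, I_4, I_6, I_10; consequently the invariant ring R_6 is finitely generated as a module over k[I_2, I_4, I_6, I_10]. -/

import Mathlib

open MvPolynomial
noncomputable section

/-- The binary form of degree `d` with coefficient vector `a`. -/
def toForm (k : Type*) [CommSemiring k] (d : ℕ) (a : Fin (d+1) → k) :
    MvPolynomial (Fin 2) k :=
  ∑ i : Fin (d+1), C (a i) * X 0 ^ (d - (i : ℕ)) * X 1 ^ (i : ℕ)

/-- Coordinate change by the matrix `g` : `X ↦ g00 X + g01 Y`, `Y ↦ g10 X + g11 Y`. -/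
def matAct (k : Type*) [CommSemiring k] (g : Matrix (Fin 2) (Fin 2) k)
    (p : MvPolynomial (Fin 2) k) : MvPolynomial (Fin 2) k :=
  aeval (fun j : Fin 2 => C (g j 0) * X 0 + C (g j 1) * X 1) p

/-- The coefficient of `X^(d-i) Y^i` in a binary form of degree `d`. -/
def formCoeff (k : Type*) [CommSemiring k] (d : ℕ) (p : MvPolynomial (Fin 2) k)
    (i : Fin (d+1)) : k :=
  coeff (Finsupp.single 0 (d - (i : ℕ)) + Finsupp.single 1 (i : ℕ)) p

/-- The induced action of a `2×2` matrix on the coefficient vector of a binary form. -/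
def actCoeff (k : Type*) [CommSemiring k] (d : ℕ) (g : Matrix (Fin 2) (Fin 2) k)
    (a : Fin (d+1) → k) : Fin (d+1) → k :=
  formCoeff k d (matAct k g (toForm k d a))

/-- `P ∈ k[A_0,…,A_d]` is an `SL₂(k)`-invariant. -/
def SL2Invariant (k : Type*) [CommRing k] (d : ℕ)
    (P : MvPolynomial (Fin (d+1)) k) : Prop :=
  ∀ g : Matrix.SpecialLinearGroup (Fin 2) k, ∀ a : Fin (d+1) → k,
    eval (actCoeff k d (g : Matrix (Fin 2) (Fin 2) k) a) P = eval a P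

/-- The ring `R_d` of `SL₂(k)`-invariants in `k[A_0,…,A_d]`. -/
def Rd (k : Type*) [Field k] (d : ℕ) : Subalgebra k (MvPolynomial (Fin (d+1)) k) where
  carrier := {P | SL2Invariant k d P}
  mul_mem' := fun hP hQ g a => by simp only [map_mul]; rw [hP g a, hQ g a]
  add_mem' := fun hP hQ g a => by simp only [map_add]; rw [hP g a, hQ g a]
  algebraMap_mem' := fun r g a => by simp [SL2Invariant]
open scoped Classical

/-- `D_{ij} = x_i y_j - x_j y_i` for the roots `(x_i , y_i)` of a binary sextic. -/
def Dij {k : Type*} [CommRing k] (x y : Fin 6 → k) (i j : Fin 6) : k :=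
  x i * y j - x j * y i

/-- `Σ D_{ij}² D_{kl}² D_{mn}²`, the sum running over the 15 partitions of `{1,…,6}`
into three pairs (each partition counted 48 times by permutations). -/
def sumPairs {k : Type*} [Field k] (x y : Fin 6 → k) : k :=
  (48 : k)⁻¹ * ∑ σ : Equiv.Perm (Fin 6),
    (Dij x y (σ 0) (σ 1))^2 * (Dij x y (σ 2) (σ 3))^2 * (Dij x y (σ 4) (σ 5))^2

/-- `Σ D_{ij}² D_{jk}² D_{ki}² D_{lm}² D_{mn}² D_{nl}²`, the sum running over the
10 partitions of `{1,…,6}` into two 3-sets (each counted 72 times by permutations). -/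
def sumB {k : Type*} [Field k] (x y : Fin 6 → k) : k :=
  (72 : k)⁻¹ * ∑ σ : Equiv.Perm (Fin 6),
    ((Dij x y (σ 0) (σ 1))^2 * (Dij x y (σ 1) (σ 2))^2 * (Dij x y (σ 2) (σ 0))^2)
    * ((Dij x y (σ 3) (σ 4))^2 * (Dij x y (σ 4) (σ 5))^2 * (Dij x y (σ 5) (σ 3))^2)

/-- The 60-term sum over pairs of matched triangles (each matched configuration
counted 12 times by permutations). -/
def sumC {k : Type*} [Field k] (x y : Fin 6 → k) : k :=
  (12 : k)⁻¹ * ∑ σ : Equiv.Perm (Fin 6),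
    ((Dij x y (σ 0) (σ 1))^2 * (Dij x y (σ 1) (σ 2))^2 * (Dij x y (σ 2) (σ 0))^2)
    * ((Dij x y (σ 3) (σ 4))^2 * (Dij x y (σ 4) (σ 5))^2 * (Dij x y (σ 5) (σ 3))^2)
    * ((Dij x y (σ 0) (σ 3))^2 * (Dij x y (σ 1) (σ 4))^2 * (Dij x y (σ 2) (σ 5))^2)

/-- The basic invariant `I₂` of a binary sextic, expressed through the roots, in the
normalization used by the paper's coefficient formulas. -/
def I2r {k : Type*} [Field k] (x y : Fin 6 → k) : k :=
  -(2 : k)⁻¹ * sumPairs x y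

/-- The basic invariant `I₄` (`= 4I₂² - B` in the paper's normalization of `B`),
expressed through the roots. -/
def I4r {k : Type*} [Field k] (x y : Fin 6 → k) : k :=
  9 * (I2r x y)^2 - 80 * sumB x y

/-- The basic invariant `I₆` (`= 8I₂³ - 160 I₂ I₄ - C` in the paper's normalization
of `C`), expressed through the roots. -/
def I6r {k : Type*} [Field k] (x y : Fin 6 → k) : k :=
  (13/108 : k) * (I2r x y)^3 - (1/108 : k) * I2r x y * I4r x y + (25/9 : k) * sumC x y

/-- The discriminant `I₁₀ = ∏_{i<j} D_{ij}²`. -/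
def I10r {k : Type*} [Field k] (x y : Fin 6 → k) : k :=
  ∏ p ∈ Finset.univ.filter (fun p : Fin 6 × Fin 6 => p.1 < p.2), (Dij x y p.1 p.2)^2

/-- The coefficient of `X^(6-j) Y^j` in the sextic `∏ (y_i X - x_i Y)`. -/
def sexticCoeff {k : Type*} [Field k] (x y : Fin 6 → k) (j : Fin 7) : k :=
  formCoeff k 6 (∏ i : Fin 6,
    (MvPolynomial.C (y i) * MvPolynomial.X 0 - MvPolynomial.C (x i) * MvPolynomial.X 1)) j

/-- The multiplicity of the `i`-th root among the six roots of the sextic. -/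
def rootMult {k : Type*} [Field k] (x y : Fin 6 → k) (i : Fin 6) : ℕ :=
  (Finset.univ.filter (fun j => x i * y j = x j * y i)).card
/-- The null cone `N_6` of binary sextics. -/
def nullCone (k : Type*) [Field k] (d : ℕ) : Set (Fin (d+1) → k) :=
  {a | ∀ (n : ℕ) (P : MvPolynomial (Fin (d+1)) k),
    SL2Invariant k d P → P.IsHomogeneous n → 0 < n → eval a P = 0}

set_option maxHeartbeats 4000000
set_option maxRecDepth 100000

theorem sum_perm_cons {M : Type*} [AddCommMonoid M] (n : ℕ) (f : (Fin (n+1) → Fin (n+1)) → M) :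
    ∑ σ : Equiv.Perm (Fin (n+1)), f σ =
      ∑ p : Fin (n+1), ∑ τ : Equiv.Perm (Fin n), f (Fin.cons p (p.succAbove ∘ τ)) := by
  have hinj : ∀ (p : Fin (n+1)) (τ : Equiv.Perm (Fin n)),
      Function.Injective (Fin.cons p (p.succAbove ∘ τ) : Fin (n+1) → Fin (n+1)) := by
    intro p τ
    rw [Fin.cons_injective_iff]
    refine ⟨?_, (Fin.succAbove_right_injective).comp τ.injective⟩
    rintro ⟨i, hi⟩
    exact Fin.succAbove_ne p _ hi
  let e : Fin (n+1) × Equiv.Perm (Fin n) → Equiv.Perm (Fin (n+1)) := fun q =>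
    Equiv.ofBijective _ (Finite.injective_iff_bijective.1 (hinj q.1 q.2))
  have he : Function.Bijective e := by
    rw [Fintype.bijective_iff_injective_and_card]
    constructor
    · rintro ⟨p, τ⟩ ⟨q, υ⟩ h
      have h' : (Fin.cons p (p.succAbove ∘ τ) : Fin (n+1) → Fin (n+1))
        = Fin.cons q (q.succAbove ∘ υ) := congrArg DFunLike.coe h
      obtain ⟨h1, h2⟩ := Fin.cons_inj.1 h'
      subst h1
      congr 1
      ext i : 1
      exact Fin.succAbove_right_injective (congrFun h2 i)
    · simp [Fintype.card_perm, Nat.factorial_succ]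
  rw [← Fintype.sum_prod_type', ← Function.Bijective.sum_comp he]
  rfl

theorem sum_perm_six {M : Type*} [AddCommMonoid M] (f : Fin 6 → Fin 6 → Fin 6 → Fin 6 → Fin 6 → Fin 6 → M) :
    ∑ σ : Equiv.Perm (Fin 6), f (σ 0) (σ 1) (σ 2) (σ 3) (σ 4) (σ 5) =
    ∑ p : Fin 6, ∑ q : Fin 5, ∑ r : Fin 4, ∑ s : Fin 3, ∑ t : Fin 2,
      f p (p.succAbove q) (p.succAbove (q.succAbove r)) (p.succAbove (q.succAbove (r.succAbove s)))
       (p.succAbove (q.succAbove (r.succAbove (s.succAbove t))))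
       (p.succAbove (q.succAbove (r.succAbove (s.succAbove (t.succAbove 0))))) := by
  rw [sum_perm_cons 5 (fun σ => f (σ 0) (σ 1) (σ 2) (σ 3) (σ 4) (σ 5))]
  refine Finset.sum_congr rfl fun p _ => ?_
  refine (sum_perm_cons 4 (fun σ => f p (p.succAbove (σ 0)) (p.succAbove (σ 1))
    (p.succAbove (σ 2)) (p.succAbove (σ 3)) (p.succAbove (σ 4)))).trans ?_
  refine Finset.sum_congr rfl fun q _ => ?_
  refine (sum_perm_cons 3 (fun σ => f p (p.succAbove q) (p.succAbove (q.succAbove (σ 0)))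
    (p.succAbove (q.succAbove (σ 1))) (p.succAbove (q.succAbove (σ 2)))
    (p.succAbove (q.succAbove (σ 3))))).trans ?_
  refine Finset.sum_congr rfl fun r _ => ?_
  refine (sum_perm_cons 2 (fun σ => f p (p.succAbove q) (p.succAbove (q.succAbove r))
    (p.succAbove (q.succAbove (r.succAbove (σ 0)))) (p.succAbove (q.succAbove (r.succAbove (σ 1))))
    (p.succAbove (q.succAbove (r.succAbove (σ 2)))))).trans ?_
  refine Finset.sum_congr rfl fun s _ => ?_
  refine (sum_perm_cons 1 (fun σ => f p (p.succAbove q) (p.succAbove (q.succAbove r))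
    (p.succAbove (q.succAbove (r.succAbove s)))
    (p.succAbove (q.succAbove (r.succAbove (s.succAbove (σ 0)))))
    (p.succAbove (q.succAbove (r.succAbove (s.succAbove (σ 1))))))).trans ?_
  refine Finset.sum_congr rfl fun t _ => ?_
  rw [Fintype.sum_unique]
  rfl

/-- squared brackets of a configuration with a double root at infinity -/
theorem m_simps {k : Type*} [Field k] (x y : Fin 6 → k) (m : Fin 6 → Fin 6 → k)
    (hm : m = fun i j => (Dij x y i j)^2)
    (hx0 : x 0 = 1) (hx1 : x 1 = 1) (hy0 : y 0 = 0) (hy1 : y 1 = 0) :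
    (m 0 1 = 0 ∧ m 1 0 = 0) ∧ (∀ j, m j 0 = y j ^ 2) ∧ (∀ j, m 0 j = y j ^ 2) ∧
    (∀ j, m j 1 = y j ^ 2) ∧ (∀ j, m 1 j = y j ^ 2) ∧
    (m 3 2 = m 2 3 ∧ m 4 2 = m 2 4 ∧ m 5 2 = m 2 5 ∧ m 4 3 = m 3 4 ∧ m 5 3 = m 3 5 ∧
      m 5 4 = m 4 5) := by
  subst hm
  simp only [Dij, hx0, hx1, hy0, hy1]
  refine ⟨⟨by ring, by ring⟩, fun j => by ring, fun j => by ring, fun j => by ring,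
    fun j => by ring, ?_⟩
  refine ⟨?_, ?_, ?_, ?_, ?_, ?_⟩ <;> ring

theorem sumPairs_double {k : Type*} [Field k] (h2 : (2:k) ≠ 0) (h3 : (3:k) ≠ 0) (x y : Fin 6 → k)
    (hx0 : x 0 = 1) (hx1 : x 1 = 1) (hy0 : y 0 = 0) (hy1 : y 1 = 0) :
    sumPairs x y = 2 * ((Dij x y 2 3)^2 * y 4 ^ 2 * y 5 ^ 2 + (Dij x y 2 4)^2 * y 3 ^ 2 * y 5 ^ 2
      + (Dij x y 2 5)^2 * y 3 ^ 2 * y 4 ^ 2 + (Dij x y 3 4)^2 * y 2 ^ 2 * y 5 ^ 2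
      + (Dij x y 3 5)^2 * y 2 ^ 2 * y 4 ^ 2 + (Dij x y 4 5)^2 * y 2 ^ 2 * y 3 ^ 2) := by
  unfold sumPairs
  obtain ⟨m, hm⟩ : ∃ m : Fin 6 → Fin 6 → k, m = fun i j => (Dij x y i j)^2 := ⟨_, rfl⟩
  have hm' : ∀ i j, (Dij x y i j)^2 = m i j := fun i j => by rw [hm]
  obtain ⟨⟨a1, a2⟩, a3, a4, a5, a6, a7, a8, a9, b1, b2, b3⟩ := m_simps x y m hm hx0 hx1 hy0 hy1
  simp only [hm']
  have h48 : (48 : k) ≠ 0 := by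
    have : (48 : k) = 2^4*3 := by norm_num
    rw [this]; simp [*]
  rw [inv_mul_eq_iff_eq_mul₀ h48, sum_perm_six (fun a b c d e f => m a b * m c d * m e f)]
  simp [Fin.sum_univ_succ, Fin.succAbove, a1, a2, a3, a4, a5, a6, a7, a8, a9, b1, b2, b3, hy0, hy1]
  ring

theorem sumB_double {k : Type*} [Field k] (h2 : (2:k) ≠ 0) (h3 : (3:k) ≠ 0) (x y : Fin 6 → k)
    (hx0 : x 0 = 1) (hx1 : x 1 = 1) (hy0 : y 0 = 0) (hy1 : y 1 = 0)
    (hy : y 2 = 1 ∧ y 3 = 1 ∧ y 4 = 1 ∧ y 5 = 1) :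
    sumB x y = 2 * ((Dij x y 2 3)^2 * (Dij x y 4 5)^2 + (Dij x y 2 4)^2 * (Dij x y 3 5)^2
      + (Dij x y 2 5)^2 * (Dij x y 3 4)^2) := by
  unfold sumB
  obtain ⟨hy2, hy3, hy4, hy5⟩ := hy
  obtain ⟨m, hm⟩ : ∃ m : Fin 6 → Fin 6 → k, m = fun i j => (Dij x y i j)^2 := ⟨_, rfl⟩
  have hm' : ∀ i j, (Dij x y i j)^2 = m i j := fun i j => by rw [hm]
  obtain ⟨⟨a1, a2⟩, a3, a4, a5, a6, a7, a8, a9, b1, b2, b3⟩ := m_simps x y m hm hx0 hx1 hy0 hy1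
  simp only [hm']
  have h72 : (72 : k) ≠ 0 := by
    have : (72 : k) = 2^3*3^2 := by norm_num
    rw [this]; simp [*]
  rw [inv_mul_eq_iff_eq_mul₀ h72, sum_perm_six (fun a b c d e f =>
    m a b * m b c * m c a * (m d e * m e f * m f d))]
  simp [Fin.sum_univ_succ, Fin.succAbove, a1, a2, a3, a4, a5, a6, a7, a8, a9, b1, b2, b3, hy0, hy1,
    hy2, hy3, hy4, hy5]
  ring

theorem sumC_double {k : Type*} [Field k] (h2 : (2:k) ≠ 0) (h3 : (3:k) ≠ 0) (x y : Fin 6 → k)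
    (hx0 : x 0 = 1) (hx1 : x 1 = 1) (hy0 : y 0 = 0) (hy1 : y 1 = 0)
    (hy : y 2 = 1 ∧ y 3 = 1 ∧ y 4 = 1 ∧ y 5 = 1)
    (hx : x 5 = - x 2 - x 3 - x 4) :
    sumC x y = -36 * (x 2 * x 3 * x 4 + x 5 * (x 2 * x 3 + x 2 * x 4 + x 3 * x 4)) ^ 2
      - 24 * (x 2 * x 3 + x 2 * x 4 + x 3 * x 4 + x 5 * (x 2 + x 3 + x 4)) ^ 3
      - 160 * (x 2 * x 3 + x 2 * x 4 + x 3 * x 4 + x 5 * (x 2 + x 3 + x 4))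
        * (x 2 * x 3 * x 4 * x 5) := by
  unfold sumC
  obtain ⟨hy2, hy3, hy4, hy5⟩ := hy
  obtain ⟨m, hm⟩ : ∃ m : Fin 6 → Fin 6 → k, m = fun i j => (Dij x y i j)^2 := ⟨_, rfl⟩
  have hm' : ∀ i j, (Dij x y i j)^2 = m i j := fun i j => by rw [hm]
  obtain ⟨⟨a1, a2⟩, a3, a4, a5, a6, a7, a8, a9, b1, b2, b3⟩ := m_simps x y m hm hx0 hx1 hy0 hy1
  simp only [hm']
  have h12 : (12 : k) ≠ 0 := by
    have : (12 : k) = 2^2*3 := by norm_num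
    rw [this]; simp [*]
  rw [inv_mul_eq_iff_eq_mul₀ h12, sum_perm_six (fun a b c d e f =>
    m a b * m b c * m c a * (m d e * m e f * m f d) * (m a d * m b e * m c f))]
  simp [Fin.sum_univ_succ, Fin.succAbove, a1, a2, a3, a4, a5, a6, a7, a8, a9, b1, b2, b3, hy0, hy1,
    hy2, hy3, hy4, hy5]
  have e : ∀ i j, m i j = (x i * y j - x j * y i)^2 := fun i j => by rw [hm]; rfl
  trans 24 * (m 2 3 * m 3 4 * m 4 5 + m 2 3 * m 3 5 * m 4 5 + m 2 4 * m 3 4 * m 3 5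
    + m 2 4 * m 4 5 * m 3 5 + m 2 5 * m 3 5 * m 3 4 + m 2 5 * m 4 5 * m 3 4
    + m 2 3 * m 2 4 * m 4 5 + m 2 3 * m 2 5 * m 4 5 + m 2 4 * m 2 3 * m 3 5 + m 2 4 * m 2 5 * m 3 5
    + m 2 5 * m 2 3 * m 3 4 + m 2 5 * m 2 4 * m 3 4)
  · ring
  · simp only [e, hy2, hy3, hy4, hy5, hx]
    ring

theorem restr_values {k : Type*} [Field k] (h2 : (2:k) ≠ 0) (h3 : (3:k) ≠ 0) (h5 : (5:k) ≠ 0)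
    (x y : Fin 6 → k)
    (hx0 : x 0 = 1) (hx1 : x 1 = 1) (hy0 : y 0 = 0) (hy1 : y 1 = 0)
    (hy : y 2 = 1 ∧ y 3 = 1 ∧ y 4 = 1 ∧ y 5 = 1)
    (hx : x 2 + x 3 + x 4 + x 5 = 0) :
    (x 2 * x 3 + x 2 * x 4 + x 3 * x 4 + x 5 * (x 2 + x 3 + x 4)) = I2r x y / 8 ∧
    x 2 * x 3 * x 4 * x 5 = (4 * I2r x y ^ 2 - I4r x y) / 3840 ∧
    (x 2 * x 3 * x 4 + x 5 * (x 2 * x 3 + x 2 * x 4 + x 3 * x 4)) ^ 2 =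
      (13/108 * I2r x y ^ 3 - 1/108 * I2r x y * I4r x y - I6r x y) / 100
      - 2/3 * (I2r x y / 8) ^ 3 - 40/9 * (I2r x y / 8) * ((4 * I2r x y ^ 2 - I4r x y) / 3840) := by
  have hx' : x 5 = - x 2 - x 3 - x 4 := by linear_combination hx
  have hA := sumPairs_double h2 h3 x y hx0 hx1 hy0 hy1
  have hB := sumB_double h2 h3 x y hx0 hx1 hy0 hy1 hy
  have hC := sumC_double h2 h3 x y hx0 hx1 hy0 hy1 hy hx'
  obtain ⟨hy2, hy3, hy4, hy5⟩ := hy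
  simp only [Dij, hy2, hy3, hy4, hy5, hx'] at hA hB
  have c8 : (8:k) ≠ 0 := by
    have : (8 : k) = 2^3 := by norm_num
    rw [this]; simp [*]
  have c3840 : (3840:k) ≠ 0 := by
    have : (3840 : k) = 2^8*3*5 := by norm_num
    rw [this]; simp [*]
  have c108 : (108:k) ≠ 0 := by
    have : (108 : k) = 2^2*3^3 := by norm_num
    rw [this]; simp [*]
  have c100 : (100:k) ≠ 0 := by
    have : (100 : k) = 2^2*5^2 := by norm_num
    rw [this]; simp [*]
  have c9 : (9:k) ≠ 0 := by
    have : (9 : k) = 3^2 := by norm_num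
    rw [this]; simp [*]
  have e2 : (x 2 * x 3 + x 2 * x 4 + x 3 * x 4 + x 5 * (x 2 + x 3 + x 4)) = I2r x y / 8 := by
    rw [eq_div_iff c8, I2r, hA, hx', neg_mul, ← mul_assoc, inv_mul_cancel₀ h2]
    ring
  have e4 : x 2 * x 3 * x 4 * x 5 = (4 * I2r x y ^ 2 - I4r x y) / 3840 := by
    rw [eq_div_iff c3840, I4r, hB, ((div_eq_iff c8).1 e2.symm), hx']
    ring
  refine ⟨e2, e4, ?_⟩
  rw [← e4, ← e2, I6r, hC]
  field_simp
  ring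

open MvPolynomial
noncomputable section

theorem exp_inj {d : ℕ} (i j : Fin (d+1))
    (h : (Finsupp.single 0 (d - (i:ℕ)) + Finsupp.single 1 (i:ℕ) : Fin 2 →₀ ℕ) =
      Finsupp.single 0 (d - (j:ℕ)) + Finsupp.single 1 (j:ℕ)) : i = j := by
  have := DFunLike.congr_fun h 1
  simp at this
  exact Fin.ext this

theorem coeff_toForm {k : Type*} [CommRing k] (d : ℕ) (a : Fin (d+1) → k) (m : Fin 2 →₀ ℕ) :
    coeff m (toForm k d a) = ∑ i : Fin (d+1),
      if (Finsupp.single 0 (d - (i:ℕ)) + Finsupp.single 1 (i:ℕ) : Fin 2 →₀ ℕ) = m then a i else 0 := by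
  classical
  unfold toForm
  rw [coeff_sum]
  refine Finset.sum_congr rfl fun i _ => ?_
  have : (C (a i) * X 0 ^ (d - (i : ℕ)) * X 1 ^ (i : ℕ) : MvPolynomial (Fin 2) k) =
      monomial (Finsupp.single 0 (d - (i:ℕ)) + Finsupp.single 1 (i:ℕ)) (a i) := by
    rw [X_pow_eq_monomial, X_pow_eq_monomial, C_mul_monomial, monomial_mul]; simp
  rw [this, coeff_monomial]

theorem formCoeff_toForm {k : Type*} [CommRing k] (d : ℕ) (a : Fin (d+1) → k) :
    formCoeff k d (toForm k d a) = a := by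
  funext j
  unfold formCoeff
  rw [coeff_toForm, Finset.sum_eq_single j]
  · simp
  · intro i _ hij
    rw [if_neg]
    exact fun h => hij (exp_inj _ _ h)
  · simp

theorem toForm_formCoeff {k : Type*} [CommRing k] (d : ℕ) (p : MvPolynomial (Fin 2) k)
    (hp : p.IsHomogeneous d) : toForm k d (formCoeff k d p) = p := by
  ext m
  rw [coeff_toForm]
  by_cases hm : m 0 + m 1 = d
  · have hlt : m 1 < d + 1 := by omega
    have hmm : (Finsupp.single 0 (d - m 1) + Finsupp.single 1 (m 1) : Fin 2 →₀ ℕ) = m := by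
      ext i
      fin_cases i
      · simp; omega
      · simp
    rw [Finset.sum_eq_single ⟨m 1, hlt⟩]
    · rw [if_pos hmm]
      exact congrArg (fun q => coeff q p) hmm
    · intro i _ hij
      rw [if_neg]
      intro h
      apply hij
      apply exp_inj
      rw [h]; exact hmm.symm
    · simp
  · rw [Finset.sum_eq_zero]
    · by_contra h
      apply hm
      have := hp (Ne.symm h)
      rw [Finsupp.weight_apply, Finsupp.sum_fintype] at this
      · simpa [Fin.sum_univ_two] using this
      · simp
    · intro i _
      rw [if_neg]
      rintro rfl
      apply hm
      simp
      omega

/-- products of linear forms -/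
def prodForm {k : Type*} [CommRing k] (x y : Fin 6 → k) : MvPolynomial (Fin 2) k :=
  ∏ i : Fin 6, (C (y i) * X 0 - C (x i) * X 1)

theorem prodForm_hom {k : Type*} [CommRing k] (x y : Fin 6 → k) :
    (prodForm x y).IsHomogeneous 6 := by
  have := IsHomogeneous.prod (Finset.univ : Finset (Fin 6))
    (fun i => (C (y i) * X 0 - C (x i) * X 1 : MvPolynomial (Fin 2) k)) (fun _ => 1)
    (fun i _ => by
      apply IsHomogeneous.sub
      · simpa using (isHomogeneous_C (Fin 2) (y i)).mul (isHomogeneous_X k (0 : Fin 2))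
      · simpa using (isHomogeneous_C (Fin 2) (x i)).mul (isHomogeneous_X k (1 : Fin 2)))
  simp only [Finset.sum_const, Finset.card_univ, Fintype.card_fin, smul_eq_mul, mul_one] at this
  exact this

theorem sexticCoeff_eq {k : Type*} [Field k] (x y : Fin 6 → k) :
    sexticCoeff x y = formCoeff k 6 (prodForm x y) := rfl

theorem act_sextic {k : Type*} [Field k] (g : Matrix (Fin 2) (Fin 2) k) (x y : Fin 6 → k) :
    actCoeff k 6 g (sexticCoeff x y) =
      sexticCoeff (fun i => g 1 1 * x i - g 0 1 * y i) (fun i => g 0 0 * y i - g 1 0 * x i) := by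
  unfold actCoeff
  rw [sexticCoeff_eq, sexticCoeff_eq, toForm_formCoeff _ _ (prodForm_hom x y)]
  refine congrArg _ ?_
  unfold matAct prodForm
  rw [map_prod]
  refine Finset.prod_congr rfl fun i _ => ?_
  simp only [map_sub, map_mul, aeval_X, aeval_C, algebraMap_eq]
  ring

theorem homogenize_split {k : Type*} [Field k] [IsAlgClosed k] (n : ℕ) :
    ∀ p : Polynomial k, p.natDegree ≤ n → ∃ (c : k) (x y : Fin n → k),
      p.homogenize n = C c * ∏ i, (C (y i) * X 0 - C (x i) * X 1) := by
  induction n with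
  | zero =>
    intro p hp
    refine ⟨p.coeff 0, 0, 0, ?_⟩
    rw [Polynomial.eq_C_of_natDegree_le_zero hp]
    simp
  | succ n ih =>
    intro p hp
    by_cases hd : p.natDegree ≤ n
    · obtain ⟨c, x, y, h⟩ := ih p hd
      refine ⟨c, Fin.cons (-1) x, Fin.cons 0 y, ?_⟩
      have := Polynomial.homogenize_mul (1 : Polynomial k) p (m := 1) (n := n) (by simp) hd
      rw [one_mul, add_comm 1 n] at this
      rw [this, h, Fin.prod_univ_succ]
      simp
      ring
    · have hne : p.degree ≠ 0 := by
        intro h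
        rw [Polynomial.natDegree_eq_zero_iff_degree_le_zero.2 h.le] at hd
        omega
      obtain ⟨r, hr⟩ := IsAlgClosed.exists_root p hne
      obtain ⟨q, rfl⟩ := Polynomial.dvd_iff_isRoot.2 hr
      have hq : q ≠ 0 := by
        rintro rfl
        simp at hd
      have hq' : q.natDegree ≤ n := by
        rw [Polynomial.natDegree_mul (Polynomial.X_sub_C_ne_zero r) hq,
          Polynomial.natDegree_X_sub_C] at hp
        omega
      obtain ⟨c, x, y, h⟩ := ih q hq'
      refine ⟨c, Fin.cons r x, Fin.cons 1 y, ?_⟩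
      have := Polynomial.homogenize_mul (Polynomial.X - Polynomial.C r) q (m := 1) (n := n)
        (by simp) hq'
      rw [add_comm 1 n] at this
      rw [this, h, Fin.prod_univ_succ]
      simp [Polynomial.homogenize_sub, Polynomial.homogenize_X]
      ring

theorem sextic_surj {k : Type*} [Field k] [IsAlgClosed k] (a : Fin 7 → k) :
    ∃ x y : Fin 6 → k, sexticCoeff x y = a := by
  let p : Polynomial k := ∑ i : Fin 7, Polynomial.monomial (6 - (i:ℕ)) (a i)
  have hp : p.natDegree ≤ 6 := by
    apply Polynomial.natDegree_sum_le_of_forall_le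
    intro i _
    exact (Polynomial.natDegree_monomial_le _).trans (by omega)
  obtain ⟨c, x, y, h⟩ := homogenize_split 6 p hp
  have hf : p.homogenize 6 = toForm k 6 a := by
    simp only [p, Polynomial.homogenize_finsetSum, toForm]
    refine Finset.sum_congr rfl fun i _ => ?_
    rw [Polynomial.homogenize_monomial (by omega)]
    rw [X_pow_eq_monomial, X_pow_eq_monomial, C_mul_monomial, monomial_mul]
    have e : (Finsupp.single 0 (6 - (i:ℕ)) + Finsupp.single 1 (i:ℕ) : Fin 2 →₀ ℕ) =
        (fun₀ | 0 => 6 - (i:ℕ) | 1 => 6 - (6 - (i:ℕ))) := by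
      have hi : 6 - (6 - (i:ℕ)) = i := by omega
      rw [hi]
      ext j
      fin_cases j <;> simp
    rw [e, mul_one, mul_one]
  refine ⟨fun i => (if i = 0 then c else 1) * x i, fun i => (if i = 0 then c else 1) * y i, ?_⟩
  have : sexticCoeff (fun i => (if i = 0 then c else 1) * x i)
      (fun i => (if i = 0 then c else 1) * y i) = formCoeff k 6 (toForm k 6 a) := by
    rw [← hf, h, sexticCoeff_eq]
    refine congrArg _ ?_
    unfold prodForm
    have : C c = ∏ i : Fin 6, (C (if i = 0 then c else 1) : MvPolynomial (Fin 2) k) := by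
      rw [← map_prod]; simp
    rw [this, ← Finset.prod_mul_distrib]
    refine Finset.prod_congr rfl fun i _ => ?_
    rw [C_mul, C_mul]
    ring
  rw [this, formCoeff_toForm]

/-- the polynomial expressing the coefficients through the roots -/
def sexPoly (k : Type*) [Field k] (j : Fin 7) : MvPolynomial (Fin 6 ⊕ Fin 6) k :=
  formCoeff (MvPolynomial (Fin 6 ⊕ Fin 6) k) 6
    (prodForm (fun i => X (Sum.inl i)) (fun i => X (Sum.inr i))) j

/-- evaluation at a configuration of six vectors -/
def ev {k : Type*} [Field k] (F : MvPolynomial (Fin 6 ⊕ Fin 6) k) (x y : Fin 6 → k) : k :=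
  eval (Sum.elim x y) F

theorem ev_sexPoly {k : Type*} [Field k] (j : Fin 7) (x y : Fin 6 → k) :
    ev (sexPoly k j) x y = sexticCoeff x y j := by
  unfold ev sexPoly sexticCoeff formCoeff
  rw [← coeff_map]
  congr 1
  unfold prodForm
  rw [map_prod]
  simp

/-- pull back a polynomial in the coefficients to the roots -/
def pull {k : Type*} [Field k] (P : MvPolynomial (Fin 7) k) : MvPolynomial (Fin 6 ⊕ Fin 6) k :=
  aeval (sexPoly k) P

theorem ev_pull {k : Type*} [Field k] (P : MvPolynomial (Fin 7) k) (x y : Fin 6 → k) :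
    ev (pull P) x y = eval (sexticCoeff x y) P := by
  have : sexticCoeff x y = fun j => eval (Sum.elim x y) (sexPoly k j) := by
    funext j; exact (ev_sexPoly j x y).symm
  rw [this]
  unfold ev pull
  rw [aeval_def, eval_eval₂]
  change _ = eval₂ (RingHom.id k) _ P
  congr 1
  ext r
  simp

/-- symmetric (up to sign), `SL₂`-invariant and multihomogeneous functions of six vectors -/
structure W {k : Type*} [Field k] (n e : ℕ) (F : MvPolynomial (Fin 6 ⊕ Fin 6) k) : Prop where
  sym : ∀ (σ : Equiv.Perm (Fin 6)) (x y : Fin 6 → k),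
    ev F (fun i => x (σ i)) (fun i => y (σ i)) = (((Equiv.Perm.sign σ : ℤˣ) : ℤ) : k) ^ e * ev F x y
  sl2 : ∀ a b c d : k, a * d - b * c = 1 → ∀ x y : Fin 6 → k,
    ev F (fun i => a * x i + b * y i) (fun i => c * x i + d * y i) = ev F x y
  scale : ∀ t x y : Fin 6 → k,
    ev F (fun i => t i * x i) (fun i => t i * y i) = (∏ i, t i) ^ n * ev F x y

theorem hom_smul {k : Type*} [Field k] {σ : Type*} (P : MvPolynomial σ k) (n : ℕ)
    (hP : P.IsHomogeneous n) (c : k) (a : σ → k) :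
    eval (fun i => c * a i) P = c ^ n * eval a P := by
  rw [eval_eq, eval_eq, Finset.mul_sum]
  refine Finset.sum_congr rfl fun d hd => ?_
  have h1 : d.sum (fun _ m => m) = n := by
    have := hP (mem_support_iff.1 hd)
    rw [Finsupp.weight_apply] at this
    simpa using this
  have h2 : ∏ i ∈ d.support, (c * a i) ^ d i = c ^ n * ∏ i ∈ d.support, a i ^ d i := by
    simp only [mul_pow]
    rw [Finset.prod_mul_distrib, Finset.prod_pow_eq_pow_sum]
    rw [← h1]; rfl
  rw [h2]; ring

theorem W_pull {k : Type*} [Field k] (n : ℕ) (P : MvPolynomial (Fin 7) k)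
    (hP : P.IsHomogeneous n) (hi : SL2Invariant k 6 P) : W n 0 (pull P) := by
  constructor
  · intro σ x y
    rw [pow_zero, one_mul, ev_pull, ev_pull]
    refine congrArg (fun a => eval a P) ?_
    rw [sexticCoeff_eq, sexticCoeff_eq]
    refine congrArg _ ?_
    exact Equiv.prod_comp σ (fun i => (C (y i) * X 0 - C (x i) * X 1 : MvPolynomial (Fin 2) k))
  · intro a b c d h x y
    rw [ev_pull, ev_pull]
    have h1 : Matrix.det !![d, -b; -c, a] = 1 := by
      rw [Matrix.det_fin_two_of]; linear_combination h
    have := hi ⟨!![d, -b; -c, a], h1⟩ (sexticCoeff x y)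
    rw [act_sextic] at this
    rw [← this]
    refine congrArg (fun a => eval a P) ?_
    refine congrArg₂ sexticCoeff ?_ ?_ <;> funext i <;> simp <;> ring
  · intro t x y
    rw [ev_pull, ev_pull, ← hom_smul P n hP]
    refine congrArg (fun a => eval a P) ?_
    rw [sexticCoeff_eq, sexticCoeff_eq]
    funext j
    unfold formCoeff
    rw [← coeff_C_mul, map_prod]
    unfold prodForm
    rw [← Finset.prod_mul_distrib]
    refine congrArg _ ?_
    refine Finset.prod_congr rfl fun i _ => ?_
    simp only [map_mul]
    ring
end

open MvPolynomial
noncomputable section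

theorem poly_zero_of_punctured {k : Type*} [Field k] [Infinite k] (p : Polynomial k)
    (h : ∀ s : k, s ≠ 0 → p.eval s = 0) : p.eval 0 = 0 := by
  have : p = 0 := by
    apply Polynomial.eq_zero_of_infinite_isRoot
    apply Set.Infinite.mono (s := ({0}ᶜ : Set k))
    · intro s hs
      exact h s hs
    · exact (Set.finite_singleton (0:k)).infinite_compl
  rw [this, Polynomial.eval_zero]

theorem poly_aeval {k : Type*} [Field k] {σ : Type*} (F : MvPolynomial σ k)
    (g : σ → Polynomial k) (s : k) :
    Polynomial.eval s (aeval g F) = eval (fun i => Polynomial.eval s (g i)) F := by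
  induction F using MvPolynomial.induction_on with
  | C a => simp
  | add p q hp hq => simp [hp, hq]
  | mul_X p i hp => simp [hp]

theorem mv_aeval {k : Type*} [Field k] {σ τ : Type*} (F : MvPolynomial σ k)
    (g : σ → MvPolynomial τ k) (v : τ → k) :
    eval v (aeval g F) = eval (fun i => eval v (g i)) F := by
  induction F using MvPolynomial.induction_on with
  | C a => simp only [aeval_C, algebraMap_eq, eval_C]
  | add p q hp hq => simp only [map_add, hp, hq]
  | mul_X p i hp => simp only [map_mul, aeval_X, eval_X, hp]

theorem null_W {k : Type*} [Field k] [Infinite k] {n e : ℕ} {F : MvPolynomial (Fin 6 ⊕ Fin 6) k}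
    (hF : W n e F) (hn : 0 < n) (x y : Fin 6 → k) (a b : Fin 6) (hab : a ≠ b)
    (hy : ∀ i, i ≠ a → i ≠ b → y i = 0) : ev F x y = 0 := by
  have key : ∀ s : k, s ≠ 0 → ev F x y = s ^ (2 * n) *
      ev F (fun i => (if i = a then s ^ 2 else 1) * (if i = b then s ^ 2 else 1) * x i) y := by
    intro s hs
    have h1 := hF.sl2 s 0 0 s⁻¹ (by simp [hs]) x y
    have h2 := hF.scale (fun i => s * ((if i = a then (s ^ 2)⁻¹ else 1) *
      (if i = b then (s ^ 2)⁻¹ else 1)))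
      (fun i => (if i = a then s ^ 2 else 1) * (if i = b then s ^ 2 else 1) * x i) y
    have h3 : (∏ i : Fin 6, (s * ((if i = a then (s ^ 2)⁻¹ else 1) *
      (if i = b then (s ^ 2)⁻¹ else 1)))) = s ^ 2 := by
      rw [Finset.prod_mul_distrib, Finset.prod_mul_distrib]
      simp
      field_simp
    rw [h3, ← pow_mul] at h2
    rw [← h1, ← h2]
    congr 1
    · funext i
      by_cases hia : i = a
      · subst hia
        simp [hab]; field_simp
      · by_cases hib : i = b
        · subst hib
          simp [hia]; field_simp
        · simp [hia, hib]
    · funext i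
      by_cases hia : i = a
      · subst hia
        simp [hab]; field_simp; simp
      · by_cases hib : i = b
        · subst hib
          simp [hia]; field_simp; simp
        · simp [hia, hib, hy i hia hib]
  let p : Polynomial k := Polynomial.C (ev F x y) - Polynomial.X ^ (2 * n) *
    aeval (Sum.elim (fun i => (if i = a then Polynomial.X ^ 2 else 1) *
      (if i = b then Polynomial.X ^ 2 else 1) * Polynomial.C (x i))
      (fun i => Polynomial.C (y i))) F
  have hp := poly_zero_of_punctured p (by
    intro s hs
    simp only [p, Polynomial.eval_sub, Polynomial.eval_mul, Polynomial.eval_pow,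
      Polynomial.eval_X, Polynomial.eval_C, poly_aeval]
    rw [sub_eq_zero, key s hs]
    unfold ev
    congr 3
    funext i
    rcases i with i | i
    · simp only [Sum.elim_inl, Polynomial.eval_mul, Polynomial.eval_C]
      split_ifs <;> simp
    · simp)
  have h0 : (0 : k) ^ (2 * n) = 0 := zero_pow (by omega)
  simpa [p, h0] using hp

theorem dvd_of_vanish {k : Type*} [Field k] [IsAlgClosed k] {σ : Type*} [Finite σ]
    (D K H : MvPolynomial σ k) (hD : Prime D) (hK : ∃ v, eval v D = 0 ∧ eval v K ≠ 0)
    (h : ∀ v, eval v D = 0 → eval v K ≠ 0 → eval v H = 0) : D ∣ H := by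
  have h1 : H * K ∈ (Ideal.span {D}).radical := by
    rw [← vanishingIdeal_zeroLocus_eq_radical (K := k)]
    rw [mem_vanishingIdeal_iff]
    intro v hv
    have hv' : eval v D = 0 := hv D (Ideal.mem_span_singleton_self D)
    change eval v (H * K) = 0
    rw [map_mul]
    by_cases hk : eval v K = 0
    · rw [hk, mul_zero]
    · rw [h v hv' hk, zero_mul]
  obtain ⟨N, hN⟩ := h1
  rw [Ideal.mem_span_singleton] at hN
  rcases hD.dvd_or_dvd (hD.dvd_of_dvd_pow hN) with h2 | h2
  · exact h2
  · exfalso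
    obtain ⟨v, hv, hv'⟩ := hK
    obtain ⟨q, rfl⟩ := h2
    simp [hv] at hv'

/-- the bracket polynomial -/
def Dpoly (k : Type*) [Field k] (i j : Fin 6) : MvPolynomial (Fin 6 ⊕ Fin 6) k :=
  X (Sum.inl i) * X (Sum.inr j) - X (Sum.inl j) * X (Sum.inr i)

theorem ev_Dpoly {k : Type*} [Field k] (i j : Fin 6) (x y : Fin 6 → k) :
    ev (Dpoly k i j) x y = Dij x y i j := by
  simp [ev, Dpoly, Dij]

theorem eval_eq_ev {k : Type*} [Field k] (F : MvPolynomial (Fin 6 ⊕ Fin 6) k)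
    (v : Fin 6 ⊕ Fin 6 → k) : eval v F = ev F (fun i => v (Sum.inl i)) (fun i => v (Sum.inr i)) := by
  unfold ev
  congr 2
  funext i
  rcases i with i | i <;> rfl

theorem ev_ext {k : Type*} [Field k] [Infinite k] {F G : MvPolynomial (Fin 6 ⊕ Fin 6) k}
    (h : ∀ x y, ev F x y = ev G x y) : F = G := by
  apply MvPolynomial.funext
  intro v
  rw [eval_eq_ev, eval_eq_ev, h]

theorem Dpoly_prime {k : Type*} [Field k] (i j : Fin 6) (hij : i ≠ j) : Prime (Dpoly k i j) := by
  rw [← irreducible_iff_prime]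
  have : Dpoly k i j = X (Sum.inr j) * X (Sum.inl i) + (-(X (Sum.inl j) * X (Sum.inr i))) := by
    unfold Dpoly; ring
  rw [this]
  apply irreducible_mul_X_add
  · exact X_ne_zero _
  · simp
  · rw [vars_neg]
    intro h
    have := vars_mul _ _ h
    simp [hij] at this
  · rw [Irreducible.isRelPrime_iff_not_dvd (X_prime).irreducible]
    rintro ⟨q, hq⟩
    have := congrArg (fun p => ev p (fun _ => 1) (fun m => if m = j then 0 else 1)) hq
    simp [ev, hij] at this

theorem Dpoly_not_dvd {k : Type*} [Field k] (i j a b : Fin 6) (hij : i < j) (hab : a < b)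
    (h : (i, j) ≠ (a, b)) : ¬ Dpoly k i j ∣ Dpoly k a b := by
  rintro ⟨q, hq⟩
  have hc : ∃ c, (c = a ∨ c = b) ∧ c ≠ i ∧ c ≠ j := by
    by_contra! hcon
    apply h
    have ha := hcon a (Or.inl rfl)
    have hb := hcon b (Or.inr rfl)
    by_cases h1 : a = i
    · by_cases h2 : b = i
      · omega
      · rw [h1, hb h2]
    · have h3 := ha h1
      by_cases h2 : b = i
      · omega
      · have := hb h2; omega
  obtain ⟨c, hc, hci, hcj⟩ := hc
  have := congrArg (fun p => ev p (fun _ => 1) (fun m => if m = c then 1 else 0)) hq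
  simp only [ev, map_mul] at this
  simp only [Dpoly] at this
  rcases hc with rfl | rfl
  · simp [hci.symm, hcj.symm, hab.ne, hab.ne'] at this
  · simp [hci.symm, hcj.symm, hab.ne, hab.ne'] at this

/-- the index set of the brackets -/
def prs : Finset (Fin 6 × Fin 6) := Finset.univ.filter (fun p : Fin 6 × Fin 6 => p.1 < p.2)

/-- the product of all brackets -/
def Del (k : Type*) [Field k] : MvPolynomial (Fin 6 ⊕ Fin 6) k := ∏ p ∈ prs, Dpoly k p.1 p.2

theorem ev_Del {k : Type*} [Field k] (x y : Fin 6 → k) :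
    ev (Del k) x y = ∏ p ∈ prs, Dij x y p.1 p.2 := by
  unfold Del
  rw [ev, map_prod]
  exact Finset.prod_congr rfl fun p _ => ev_Dpoly p.1 p.2 x y

theorem Del_dvd {k : Type*} [Field k] (F : MvPolynomial (Fin 6 ⊕ Fin 6) k)
    (h : ∀ i j, i < j → Dpoly k i j ∣ F) : Del k ∣ F := by
  unfold Del
  apply Finset.prod_dvd_of_isRelPrime
  · intro p hp q hq hpq
    simp only [prs, Finset.coe_filter, Finset.mem_univ, true_and, Set.mem_ofPred_eq] at hp hq
    change IsRelPrime (Dpoly k p.1 p.2) (Dpoly k q.1 q.2)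
    rw [Irreducible.isRelPrime_iff_not_dvd (Dpoly_prime _ _ hp.ne).irreducible]
    exact Dpoly_not_dvd _ _ _ _ hp hq hpq
  · intro p hp
    simp only [prs, Finset.mem_filter, Finset.mem_univ, true_and] at hp
    exact h _ _ hp

theorem Del_ne_zero {k : Type*} [Field k] : Del k ≠ 0 := by
  unfold Del
  rw [Finset.prod_ne_zero_iff]
  intro p hp
  simp only [prs, Finset.mem_filter, Finset.mem_univ, true_and] at hp
  exact (Dpoly_prime _ _ hp.ne).ne_zero

theorem prod_prs {M : Type*} [CommMonoid M] (f : Fin 6 → Fin 6 → M) :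
    ∏ p ∈ prs, f p.1 p.2 = ∏ i : Fin 6, ∏ j ∈ Finset.Ioi i, f i j := by
  unfold prs
  rw [Finset.prod_filter, Fintype.prod_prod_type]
  refine Finset.prod_congr rfl fun i _ => ?_
  rw [← Finset.prod_filter]
  refine Finset.prod_congr ?_ fun _ _ => rfl
  ext j; simp

theorem ev_Del_det {k : Type*} [Field k] (x y : Fin 6 → k) :
    ev (Del k) x y = (Matrix.projVandermonde y x).det := by
  rw [ev_Del, Matrix.det_projVandermonde, prod_prs (fun i j => Dij x y i j)]
  refine Finset.prod_congr rfl fun i _ => Finset.prod_congr rfl fun j _ => ?_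
  unfold Dij; ring

theorem W_Del {k : Type*} [Field k] : W 5 1 (Del k) := by
  constructor
  · intro σ x y
    rw [ev_Del_det, ev_Del_det, pow_one, ← Matrix.det_permute]
    rfl
  · intro a b c d h x y
    rw [ev_Del, ev_Del]
    refine Finset.prod_congr rfl fun p _ => ?_
    unfold Dij
    linear_combination (x p.1 * y p.2 - x p.2 * y p.1) * h
  · intro t x y
    rw [ev_Del, ev_Del]
    have : ∀ p ∈ prs, Dij (fun i => t i * x i) (fun i => t i * y i) p.1 p.2
      = (t p.1 * t p.2) * Dij x y p.1 p.2 := by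
      intro p _; unfold Dij; ring
    rw [Finset.prod_congr rfl this, Finset.prod_mul_distrib]
    congr 1
    unfold prs
    rw [Finset.prod_filter, Fintype.prod_prod_type]
    simp [Fin.prod_univ_succ]
    ring

theorem I10r_eq {k : Type*} [Field k] (x y : Fin 6 → k) : I10r x y = ev (Del k) x y ^ 2 := by
  rw [ev_Del]
  unfold I10r
  rw [Finset.prod_pow]
  rfl
end

open MvPolynomial
noncomputable section

theorem mv_cancel {k : Type*} [Field k] [Infinite k] {τ : Type*} (D A B : MvPolynomial τ k)
    (hD : D ≠ 0) (h : ∀ v, eval v D * eval v A = eval v D * eval v B) (v : τ → k) :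
    eval v A = eval v B := by
  have : D * A = D * B := by
    apply MvPolynomial.funext
    intro v
    rw [map_mul, map_mul, h]
  rw [mul_left_cancel₀ hD this]

theorem ev_mul {k : Type*} [Field k] (F G : MvPolynomial (Fin 6 ⊕ Fin 6) k) (x y : Fin 6 → k) :
    ev (F * G) x y = ev F x y * ev G x y := map_mul _ _ _

theorem ev_sub {k : Type*} [Field k] (F G : MvPolynomial (Fin 6 ⊕ Fin 6) k) (x y : Fin 6 → k) :
    ev (F - G) x y = ev F x y - ev G x y := map_sub _ _ _

theorem ev_cancel {k : Type*} [Field k] [Infinite k] (D A B : MvPolynomial (Fin 6 ⊕ Fin 6) k)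
    (hD : D ≠ 0) (h : ∀ x y, ev D x y * ev A x y = ev D x y * ev B x y) (x y : Fin 6 → k) :
    ev A x y = ev B x y := by
  apply mv_cancel D A B hD
  intro v
  rw [eval_eq_ev, eval_eq_ev, eval_eq_ev, h]

theorem ev_perm {k : Type*} [Field k] (G : MvPolynomial (Fin 6 ⊕ Fin 6) k)
    (σ : Equiv.Perm (Fin 6)) (x y : Fin 6 → k) :
    ev (rename (Sum.map σ σ) G) x y = ev G (fun i => x (σ i)) (fun i => y (σ i)) := by
  unfold ev
  rw [eval_rename]
  congr 2
  funext i
  rcases i with i | i <;> rfl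

/-- linear substitution -/
def linsub {k : Type*} [Field k] (a b c d : k) (G : MvPolynomial (Fin 6 ⊕ Fin 6) k) :
    MvPolynomial (Fin 6 ⊕ Fin 6) k :=
  aeval (Sum.elim (fun i => C a * X (Sum.inl i) + C b * X (Sum.inr i))
    (fun i => C c * X (Sum.inl i) + C d * X (Sum.inr i)) : Fin 6 ⊕ Fin 6 →
      MvPolynomial (Fin 6 ⊕ Fin 6) k) G

theorem ev_linsub {k : Type*} [Field k] (a b c d : k) (G : MvPolynomial (Fin 6 ⊕ Fin 6) k)
    (x y : Fin 6 → k) :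
    ev (linsub a b c d G) x y = ev G (fun i => a * x i + b * y i) (fun i => c * x i + d * y i) := by
  unfold ev linsub
  rw [mv_aeval]
  congr 2
  funext i
  rcases i with i | i <;> simp

/-- scaling substitution with generic scalars -/
def scsub {k : Type*} [Field k] (G : MvPolynomial (Fin 6 ⊕ Fin 6) k) :
    MvPolynomial (Fin 6 ⊕ (Fin 6 ⊕ Fin 6)) k :=
  aeval (Sum.elim (fun i => X (Sum.inl i) * X (Sum.inr (Sum.inl i)))
    (fun i => X (Sum.inl i) * X (Sum.inr (Sum.inr i))) : Fin 6 ⊕ Fin 6 →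
      MvPolynomial (Fin 6 ⊕ (Fin 6 ⊕ Fin 6)) k) G

theorem ev_scsub {k : Type*} [Field k] (G : MvPolynomial (Fin 6 ⊕ Fin 6) k)
    (t x y : Fin 6 → k) :
    eval (Sum.elim t (Sum.elim x y)) (scsub G) =
      ev G (fun i => t i * x i) (fun i => t i * y i) := by
  unfold ev scsub
  rw [mv_aeval]
  congr 2
  funext i
  rcases i with i | i <;> simp

theorem ev_inr {k : Type*} [Field k] (G : MvPolynomial (Fin 6 ⊕ Fin 6) k)
    (t x y : Fin 6 → k) :
    eval (Sum.elim t (Sum.elim x y)) (rename Sum.inr G) = ev G x y := by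
  unfold ev
  rw [eval_rename]
  rfl

/-- the product of the generic scalars -/
def pT (k : Type*) [Field k] : MvPolynomial (Fin 6 ⊕ (Fin 6 ⊕ Fin 6)) k :=
  ∏ i : Fin 6, X (Sum.inl i)

theorem ev_pT {k : Type*} [Field k] (t x y : Fin 6 → k) :
    eval (Sum.elim t (Sum.elim x y)) (pT k) = ∏ i, t i := by
  unfold pT
  rw [map_prod]
  simp

theorem pT_ne_zero {k : Type*} [Field k] : pT k ≠ 0 := by
  unfold pT
  rw [Finset.prod_ne_zero_iff]
  intro i _
  exact X_ne_zero _

theorem ev_cancelT {k : Type*} [Field k] [Infinite k] (D G : MvPolynomial (Fin 6 ⊕ Fin 6) k)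
    (hD : D ≠ 0) (a b c : ℕ)
    (h : ∀ t x y : Fin 6 → k, (∏ i, t i) ^ a * ev D x y *
      ((∏ i, t i) ^ b * ev G (fun i => t i * x i) (fun i => t i * y i))
      = (∏ i, t i) ^ a * ev D x y * ((∏ i, t i) ^ c * ev G x y)) (t x y : Fin 6 → k) :
    (∏ i, t i) ^ b * ev G (fun i => t i * x i) (fun i => t i * y i) = (∏ i, t i) ^ c * ev G x y := by
  have h0 : (pT k) ^ a * rename Sum.inr D ≠ 0 := by
    apply mul_ne_zero (pow_ne_zero _ pT_ne_zero)
    intro h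
    apply hD
    exact rename_injective _ Sum.inr_injective (h.trans (map_zero _).symm)
  have := mv_cancel ((pT k) ^ a * rename Sum.inr D) ((pT k) ^ b * scsub G)
    ((pT k) ^ c * rename Sum.inr G) h0 (by
      intro v
      obtain ⟨t, x, y, rfl⟩ : ∃ t x y, v = Sum.elim t (Sum.elim x y) := by
        refine ⟨fun i => v (Sum.inl i), fun i => v (Sum.inr (Sum.inl i)),
          fun i => v (Sum.inr (Sum.inr i)), ?_⟩
        funext i
        rcases i with i | i | i <;> rfl
      simp only [map_mul, map_pow, ev_pT, ev_scsub, ev_inr]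
      exact h t x y) (Sum.elim t (Sum.elim x y))
  simpa only [map_mul, map_pow, ev_pT, ev_scsub, ev_inr] using this

theorem sgn_sq {k : Type*} [Field k] (σ : Equiv.Perm (Fin 6)) :
    (((Equiv.Perm.sign σ : ℤˣ) : ℤ) : k) * (((Equiv.Perm.sign σ : ℤˣ) : ℤ) : k) = 1 := by
  rw [← Int.cast_mul, ← Units.val_mul, Int.units_mul_self]
  simp

theorem W_quot {k : Type*} [Field k] [Infinite k] {n e : ℕ}
    {F G : MvPolynomial (Fin 6 ⊕ Fin 6) k} (hF : W n e F) (hF0 : F ≠ 0) (h : F = Del k * G) :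
    5 ≤ n ∧ W (n - 5) (e + 1) G := by
  have hD := Del_ne_zero (k := k)
  have WD := W_Del (k := k)
  have hG : G ≠ 0 := by rintro rfl; simp at h; exact hF0 h
  have hsc : ∀ t x y : Fin 6 → k, (∏ i, t i) ^ 5 * ev (Del k) x y *
      ev G (fun i => t i * x i) (fun i => t i * y i)
      = (∏ i, t i) ^ n * (ev (Del k) x y * ev G x y) := by
    intro t x y
    have := hF.scale t x y
    rw [h, ev_mul, ev_mul, WD.scale] at this
    exact this
  have h5 : 5 ≤ n := by
    by_contra hn
    apply hG
    apply ev_ext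
    intro x y
    have := ev_cancelT (Del k) G hD n (5 - n) 0 (by
      intro t x y
      have h1 := hsc t x y
      have h2 : (∏ i, t i) ^ 5 = (∏ i, t i) ^ n * (∏ i, t i) ^ (5 - n) := by
        rw [← pow_add]; congr 1; omega
      rw [h2] at h1
      linear_combination h1) 0 x y
    have h0 : (0 : k) ^ (5 - n) = 0 := zero_pow (by omega)
    simp [h0] at this
    rw [← this]
    simp [ev]
  refine ⟨h5, ?_, ?_, ?_⟩
  · intro σ x y
    have := ev_cancel (Del k) (rename (Sum.map σ σ) G)
      (C ((((Equiv.Perm.sign σ : ℤˣ) : ℤ) : k) ^ (e+1)) * G) hD (by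
        intro x y
        have h1 := hF.sym σ x y
        rw [h, ev_mul, ev_mul, WD.sym, pow_one] at h1
        rw [ev_perm, ev_mul]
        have h2 := sgn_sq (k := k) σ
        have h3 : ev (C ((((Equiv.Perm.sign σ : ℤˣ) : ℤ) : k) ^ (e+1))) x y =
          (((Equiv.Perm.sign σ : ℤˣ) : ℤ) : k) ^ (e+1) := by simp [ev]
        rw [h3, pow_succ]
        generalize (((Equiv.Perm.sign σ : ℤˣ) : ℤ) : k) = s at *
        linear_combination s * h1 - ev (Del k) x y * ev G (fun i => x (σ i)) (fun i => y (σ i)) * h2)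
        x y
    rw [ev_perm, ev_mul] at this
    rw [this]
    simp [ev]
  · intro a b c d hd x y
    have := ev_cancel (Del k) (linsub a b c d G) G hD (by
      intro x y
      have h1 := hF.sl2 a b c d hd x y
      rw [h, ev_mul, ev_mul, WD.sl2 a b c d hd] at h1
      rw [ev_linsub, h1]) x y
    rw [ev_linsub] at this
    exact this
  · intro t x y
    have := ev_cancelT (Del k) G hD 5 0 (n - 5) (by
      intro t x y
      have h1 := hsc t x y
      have h2 : (∏ i, t i) ^ n = (∏ i, t i) ^ 5 * (∏ i, t i) ^ (n - 5) := by
        rw [← pow_add]; congr 1; omega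
      rw [h2] at h1
      linear_combination h1) t x y
    simpa using this

theorem W_sub {k : Type*} [Field k] {n e : ℕ} {F G : MvPolynomial (Fin 6 ⊕ Fin 6) k}
    (hF : W n e F) (hG : W n e G) : W n e (F - G) := by
  constructor
  · intro σ x y; rw [ev_sub, ev_sub, hF.sym, hG.sym]; ring
  · intro a b c d h x y; rw [ev_sub, ev_sub, hF.sl2 a b c d h, hG.sl2 a b c d h]
  · intro t x y; rw [ev_sub, ev_sub, hF.scale, hG.scale]; ring

theorem W_two {k : Type*} [Field k] {n : ℕ} {F : MvPolynomial (Fin 6 ⊕ Fin 6) k}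
    (hF : W n 2 F) : W n 0 F := by
  refine ⟨?_, hF.sl2, hF.scale⟩
  intro σ x y
  rw [hF.sym, pow_two, sgn_sq, pow_zero]

theorem exists_perm01 (i j : Fin 6) (hij : i ≠ j) :
    ∃ σ : Equiv.Perm (Fin 6), σ 0 = i ∧ σ 1 = j := by
  refine ⟨Equiv.swap (Equiv.swap 0 i 1) j * Equiv.swap 0 i, ?_, ?_⟩
  · rw [Equiv.Perm.mul_apply, Equiv.swap_apply_left]
    apply Equiv.swap_apply_of_ne_of_ne _ hij
    intro h
    have := (Equiv.swap (0 : Fin 6) i).injective ((Equiv.swap_apply_left 0 i).trans h)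
    simp at this
  · rw [Equiv.Perm.mul_apply, Equiv.swap_apply_left]

/-- a bracket dividing a (skew) symmetric function can be moved by permutations -/
theorem all_dvd {k : Type*} [Field k] [IsAlgClosed k] {n e : ℕ}
    {F : MvPolynomial (Fin 6 ⊕ Fin 6) k} (hF : W n e F) (h : Dpoly k 0 1 ∣ F) : Del k ∣ F := by
  apply Del_dvd
  intro i j hij
  obtain ⟨σ, h0, h1⟩ : ∃ σ : Equiv.Perm (Fin 6), σ 0 = i ∧ σ 1 = j :=
    exists_perm01 i j hij.ne
  obtain ⟨q, hq⟩ := h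
  apply dvd_of_vanish (Dpoly k i j) 1 F (Dpoly_prime i j hij.ne)
  · exact ⟨0, by simp [Dpoly], by simp⟩
  · intro v hv _
    rw [eval_eq_ev] at hv ⊢
    rw [ev_Dpoly] at hv
    have h2 := hF.sym σ (fun i => v (Sum.inl i)) (fun i => v (Sum.inr i))
    rw [hq, ev_mul, ev_Dpoly] at h2
    rw [← hq] at h2
    simp only [Dij] at h2 hv
    rw [h0, h1, hv, zero_mul] at h2
    have h3 : (((Equiv.Perm.sign σ : ℤˣ) : ℤ) : k) ^ e ≠ 0 :=
      pow_ne_zero _ (left_ne_zero_of_mul_eq_one (sgn_sq σ))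
    exact (mul_eq_zero.1 h2.symm).resolve_left h3
end

open MvPolynomial
noncomputable section

theorem std_form {k : Type*} [Field k] (x y : Fin 6 → k) (hD : Dij x y 0 1 = 0)
    (h0 : x 0 ≠ 0 ∨ y 0 ≠ 0) (h1 : x 1 ≠ 0 ∨ y 1 ≠ 0) :
    ∃ (x' y' : Fin 6 → k) (T : k), T ≠ 0 ∧
      (∀ (n e : ℕ) (F : MvPolynomial (Fin 6 ⊕ Fin 6) k), W n e F →
        ev F x' y' = T ^ n * ev F x y) ∧
      x' 0 = 1 ∧ x' 1 = 1 ∧ y' 0 = 0 ∧ y' 1 = 0 ∧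
      ∀ j, j ≠ 1 → y' j = Dij x y 0 j := by
  unfold Dij at hD
  obtain ⟨a, b, hab⟩ : ∃ a b : k, a * x 0 + b * y 0 = 1 := by
    rcases h0 with h | h
    · exact ⟨(x 0)⁻¹, 0, by simp [h]⟩
    · exact ⟨0, (y 0)⁻¹, by simp [h]⟩
  have hdet : a * x 0 - b * (-y 0) = 1 := by linear_combination hab
  set μ := a * x 1 + b * y 1 with hμ
  have hμ0 : μ ≠ 0 := by
    intro h
    have e1 : x 1 = 0 := by linear_combination (-x 1) * hab + x 0 * h - b * hD
    have e2 : y 1 = 0 := by linear_combination (-y 1) * hab + y 0 * h + a * hD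
    simp [e1, e2] at h1
  let t : Fin 6 → k := fun i => if i = 1 then μ⁻¹ else 1
  refine ⟨fun i => t i * (a * x i + b * y i), fun i => t i * (-y 0 * x i + x 0 * y i), μ⁻¹,
    inv_ne_zero hμ0, ?_, ?_, ?_, ?_, ?_, ?_⟩
  · intro n e F hF
    have e1 := hF.scale t (fun i => a * x i + b * y i) (fun i => -y 0 * x i + x 0 * y i)
    rw [e1, hF.sl2 a b (-y 0) (x 0) hdet]
    congr 2
    simp [t]
  · simp [t, hab]
  · simp only [t, if_true]
    rw [← hμ, inv_mul_cancel₀ hμ0]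
  · simp [t]; ring
  · simp only [t, if_true]
    rw [show -y 0 * x 1 + x 0 * y 1 = 0 by linear_combination hD, mul_zero]
  · intro j hj
    simp [t, hj, Dij]; ring

/-- the y-coordinates of the special configurations -/
def ys (k : Type*) [Field k] : Fin 6 → k := ![0, 0, 1, 1, 1, 1]

theorem spec_form {k : Type*} [Field k] (h2 : (2 : k) ≠ 0) (x y : Fin 6 → k)
    (hx0 : x 0 = 1) (hx1 : x 1 = 1) (hy0 : y 0 = 0) (hy1 : y 1 = 0)
    (hy : y 2 ≠ 0 ∧ y 3 ≠ 0 ∧ y 4 ≠ 0 ∧ y 5 ≠ 0) :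
    ∃ (x' : Fin 6 → k) (T c : k), T ≠ 0 ∧
      (∀ (n e : ℕ) (F : MvPolynomial (Fin 6 ⊕ Fin 6) k), W n e F →
        ev F x' (ys k) = T ^ n * ev F x y) ∧
      x' 0 = 1 ∧ x' 1 = 1 ∧ x' 2 + x' 3 + x' 4 + x' 5 = 0 := by
  obtain ⟨e2, e3, e4, e5⟩ := hy
  let t : Fin 6 → k := ![1, 1, (y 2)⁻¹, (y 3)⁻¹, (y 4)⁻¹, (y 5)⁻¹]
  let c : k := ((y 2)⁻¹ * x 2 + (y 3)⁻¹ * x 3 + (y 4)⁻¹ * x 4 + (y 5)⁻¹ * x 5) / 4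
  have h4 : (4 : k) ≠ 0 := by
    have : (4 : k) = 2 * 2 := by norm_num
    rw [this]; exact mul_ne_zero h2 h2
  have hys : ys k = fun i => 0 * (t i * x i) + 1 * (t i * y i) := by
    funext i
    fin_cases i <;> simp [ys, t, hy0, hy1, e2, e3, e4, e5]
  refine ⟨fun i => 1 * (t i * x i) + (-c) * (t i * y i), ∏ i, t i, c, ?_, ?_, ?_, ?_, ?_⟩
  · simp [t, Fin.prod_univ_succ, e2, e3, e4, e5]
  · intro n e F hF
    rw [hys]
    rw [hF.sl2 1 (-c) 0 1 (by ring) (fun i => t i * x i) (fun i => t i * y i), hF.scale]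
  · simp [t, hx0, hy0]
  · simp [t, hx1, hy1]
  · simp [t, c, e2, e3, e4, e5]
    field_simp
    ring

theorem D01_dvd {k : Type*} [Field k] [IsAlgClosed k] (h2 : (2 : k) ≠ 0) {n e : ℕ}
    {H : MvPolynomial (Fin 6 ⊕ Fin 6) k} (hH : W n e H)
    (hs : ∀ x : Fin 6 → k, x 0 = 1 → x 1 = 1 → x 2 + x 3 + x 4 + x 5 = 0 → ev H x (ys k) = 0) :
    Dpoly k 0 1 ∣ H := by
  apply dvd_of_vanish (Dpoly k 0 1) (X (Sum.inr 0) * X (Sum.inr 1) *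
    (Dpoly k 0 2 * Dpoly k 0 3 * Dpoly k 0 4 * Dpoly k 0 5)) H (Dpoly_prime _ _ (by decide))
  · refine ⟨Sum.elim ![0, 0, 1, 1, 1, 1] ![1, 1, 0, 0, 0, 0], ?_, ?_⟩
    · simp [Dpoly]
    · simp [Dpoly]
  · intro v hv hK
    rw [eval_eq_ev] at hv ⊢
    have hK' : v (Sum.inr 0) * v (Sum.inr 1) * (ev (Dpoly k 0 2) (fun i => v (Sum.inl i)) (fun i => v (Sum.inr i))
      * ev (Dpoly k 0 3) (fun i => v (Sum.inl i)) (fun i => v (Sum.inr i)) *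
      ev (Dpoly k 0 4) (fun i => v (Sum.inl i)) (fun i => v (Sum.inr i)) *
      ev (Dpoly k 0 5) (fun i => v (Sum.inl i)) (fun i => v (Sum.inr i))) ≠ 0 := by
      intro h; apply hK
      simp only [← eval_eq_ev] at h
      simp only [map_mul, eval_X]
      exact h
    generalize (fun i => v (Sum.inl i)) = x at *
    rw [show v (Sum.inr 0) = (fun i => v (Sum.inr i)) 0 from rfl,
      show v (Sum.inr 1) = (fun i => v (Sum.inr i)) 1 from rfl] at hK'
    generalize (fun i => v (Sum.inr i)) = y at *
    simp only [ev_Dpoly] at hv hK'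
    simp only [ne_eq, mul_eq_zero, not_or] at hK'
    obtain ⟨⟨k0, k1⟩, ⟨⟨k2, k3⟩, k4⟩, k5⟩ := hK'
    obtain ⟨x', y', T, hT, hW, a0, a1, b0, b1, hy⟩ := std_form x y hv (Or.inr k0) (Or.inr k1)
    obtain ⟨x'', T', c, hT', hW', a0', a1', hsum⟩ := spec_form h2 x' y' a0 a1 b0 b1
      ⟨by rw [hy 2 (by decide)]; exact k2, by rw [hy 3 (by decide)]; exact k3,
       by rw [hy 4 (by decide)]; exact k4, by rw [hy 5 (by decide)]; exact k5⟩
    have := hs x'' a0' a1' hsum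
    rw [hW' n e H hH, hW n e H hH] at this
    simpa [hT, hT'] using this

theorem D01_dvd_skew {k : Type*} [Field k] [IsAlgClosed k] (h2 : (2 : k) ≠ 0) {n : ℕ}
    {H : MvPolynomial (Fin 6 ⊕ Fin 6) k} (hH : W n 1 H) : Dpoly k 0 1 ∣ H := by
  apply dvd_of_vanish (Dpoly k 0 1) (X (Sum.inr 0) * X (Sum.inr 1)) H (Dpoly_prime _ _ (by decide))
  · refine ⟨Sum.elim ![0, 0, 1, 1, 1, 1] ![1, 1, 0, 0, 0, 0], ?_, ?_⟩
    · simp [Dpoly]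
    · simp
  · intro v hv hK
    rw [eval_eq_ev] at hv ⊢
    rw [map_mul, eval_X, eval_X] at hK
    rw [ev_Dpoly] at hv
    obtain ⟨x', y', T, hT, hW, a0, a1, b0, b1, hy⟩ := std_form _ _ hv
      (Or.inr (left_ne_zero_of_mul hK)) (Or.inr (right_ne_zero_of_mul hK))
    have h3 := hH.sym (Equiv.swap 0 1) x' y'
    have ex : (fun i => x' (Equiv.swap (0 : Fin 6) 1 i)) = x' := by
      funext i
      rw [Equiv.swap_apply_def]
      split_ifs with p q
      · rw [p, a0, a1]
      · rw [q, a0, a1]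
      · rfl
    have ey : (fun i => y' (Equiv.swap (0 : Fin 6) 1 i)) = y' := by
      funext i
      rw [Equiv.swap_apply_def]
      split_ifs with p q
      · rw [p, b0, b1]
      · rw [q, b0, b1]
      · rfl
    rw [ex, ey, Equiv.Perm.sign_swap (by decide)] at h3
    have h4 : (2 : k) * ev H x' y' = 0 := by
      simp at h3
      linear_combination h3
    rw [hW n 1 H hH] at h4
    simpa [h2, hT] using h4

theorem disc_dvd {k : Type*} [Field k] [IsAlgClosed k] (h2 : (2 : k) ≠ 0) {n : ℕ}
    {H : MvPolynomial (Fin 6 ⊕ Fin 6) k} (hH : W n 0 H) (hne : H ≠ 0)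
    (hs : ∀ x : Fin 6 → k, x 0 = 1 → x 1 = 1 → x 2 + x 3 + x 4 + x 5 = 0 → ev H x (ys k) = 0) :
    10 ≤ n ∧ ∃ G, W (n - 10) 0 G ∧ H = Del k * (Del k * G) := by
  obtain ⟨G, hG⟩ := all_dvd hH (D01_dvd h2 hH hs)
  obtain ⟨h5, hGW⟩ := W_quot hH hne hG
  have hG0 : G ≠ 0 := by rintro rfl; simp at hG; exact hne hG
  obtain ⟨G', hG'⟩ := all_dvd hGW (D01_dvd_skew h2 hGW)
  obtain ⟨h5', hGW'⟩ := W_quot hGW hG0 hG'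
  refine ⟨by omega, G', ?_, by rw [hG, hG']⟩
  have : n - 5 - 5 = n - 10 := by omega
  rw [this] at hGW'
  exact W_two hGW'
end

open MvPolynomial
noncomputable section

/-- x-coordinates of the special configurations -/
def xs {k : Type*} [Field k] (z : Fin 4 → k) : Fin 6 → k := ![1, 1, z 0, z 1, z 2, z 3]

/-- values of the elementary symmetric functions -/
def es {k : Type*} [Field k] (z : Fin 4 → k) : Fin 4 → k :=
  ![z 0 + z 1 + z 2 + z 3,
    z 0 * z 1 + z 0 * z 2 + z 1 * z 2 + z 3 * (z 0 + z 1 + z 2),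
    z 0 * z 1 * z 2 + z 3 * (z 0 * z 1 + z 0 * z 2 + z 1 * z 2),
    z 0 * z 1 * z 2 * z 3]

theorem es_scale {k : Type*} [Field k] (z : Fin 4 → k) (s : k) (i : Fin 4) :
    es (fun i => s * z i) i = s ^ ((i : ℕ) + 1) * es z i := by
  fin_cases i <;> simp [es] <;> ring

theorem eval_esymm {k : Type*} [Field k] (z : Fin 4 → k) (i : Fin 4) :
    eval z (esymm (Fin 4) k ((i : ℕ) + 1)) = es z i := by
  have h1 : Finset.powersetCard 1 (Finset.univ : Finset (Fin 4)) = {{0}, {1}, {2}, {3}} := by decide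
  have h2 : Finset.powersetCard 2 (Finset.univ : Finset (Fin 4)) =
    {{0, 1}, {0, 2}, {1, 2}, {0, 3}, {1, 3}, {2, 3}} := by decide
  have h3 : Finset.powersetCard 3 (Finset.univ : Finset (Fin 4)) =
    {{0, 1, 2}, {0, 1, 3}, {0, 2, 3}, {1, 2, 3}} := by decide
  have h4 : Finset.powersetCard 4 (Finset.univ : Finset (Fin 4)) = {{0, 1, 2, 3}} := by decide
  fin_cases i
  · simp only [esymm, Fin.zero_eta, Fin.val_zero, zero_add, h1, es]
    rw [Finset.sum_insert (by decide), Finset.sum_insert (by decide), Finset.sum_insert (by decide)]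
    simp
    ring
  · simp only [esymm, Fin.mk_one, Fin.val_one, Nat.reduceAdd, h2, es]
    rw [Finset.sum_insert (by decide), Finset.sum_insert (by decide), Finset.sum_insert (by decide),
      Finset.sum_insert (by decide), Finset.sum_insert (by decide)]
    simp
    ring
  · simp only [esymm, Fin.reduceFinMk, Fin.val_two, Nat.reduceAdd, h3, es]
    rw [Finset.sum_insert (by decide), Finset.sum_insert (by decide), Finset.sum_insert (by decide)]
    simp
    ring
  · simp only [esymm, Nat.reduceAdd, h4, es]
    simp
    ring

theorem xs_perm {k : Type*} [Field k] (τ : Equiv.Perm (Fin 4)) : ∃ σ : Equiv.Perm (Fin 6),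
    (∀ z : Fin 4 → k, (fun i => xs z (σ i)) = xs (fun j => z (τ j))) ∧
    (fun i => ys k (σ i)) = ys k := by
  let E : Fin 2 ⊕ Fin 4 ≃ Fin 6 := finSumFinEquiv
  have hx : ∀ (z : Fin 4 → k) j, xs z (E j) = Sum.elim (fun _ => 1) z j := by
    intro z j
    rcases j with j | j <;> fin_cases j <;> rfl
  have hy : ∀ j, ys k (E j) = Sum.elim (fun _ => 0) (fun _ => 1) j := by
    intro j
    rcases j with j | j <;> fin_cases j <;> rfl
  refine ⟨E.symm.trans ((Equiv.sumCongr (Equiv.refl _) τ).trans E), ?_, ?_⟩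
  · intro z
    funext i
    obtain ⟨j, rfl⟩ := E.surjective i
    simp only [Equiv.trans_apply, Equiv.symm_apply_apply, hx]
    rcases j with j | j <;> simp
  · funext i
    obtain ⟨j, rfl⟩ := E.surjective i
    simp only [Equiv.trans_apply, Equiv.symm_apply_apply, hy]
    rcases j with j | j <;> simp

theorem restr_sym {k : Type*} [Field k] [Infinite k] {n : ℕ} {F : MvPolynomial (Fin 6 ⊕ Fin 6) k}
    (hF : W n 0 F) : ∃ Q : MvPolynomial (Fin 4) k, ∀ z, ev F (xs z) (ys k) = eval (es z) Q := by
  let c : MvPolynomial (Fin 4) k := aeval (Sum.elim ![1, 1, X 0, X 1, X 2, X 3]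
    ![0, 0, 1, 1, 1, 1] : Fin 6 ⊕ Fin 6 → MvPolynomial (Fin 4) k) F
  have hc : ∀ z, eval z c = ev F (xs z) (ys k) := by
    intro z
    simp only [c]
    rw [mv_aeval]
    unfold ev
    congr 2
    funext i
    rcases i with i | i <;> fin_cases i <;> simp [xs, ys]
  have hsym : c.IsSymmetric := by
    intro τ
    apply MvPolynomial.funext
    intro z
    rw [eval_rename, hc, hc]
    obtain ⟨σ, h1, h2⟩ := xs_perm (k := k) τ
    have := hF.sym σ (xs z) (ys k)
    rw [h1, h2, pow_zero, one_mul] at this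
    exact this
  obtain ⟨Q, hQ⟩ := esymmAlgHom_surjective (σ := Fin 4) k (n := 4) (by simp)
    (⟨c, hsym⟩ : symmetricSubalgebra (Fin 4) k)
  refine ⟨Q, fun z => ?_⟩
  rw [← hc]
  have h3 : c = aeval (fun i : Fin 4 => esymm (Fin 4) k ((i : ℕ) + 1)) Q := by
    have := congrArg (Subalgebra.val _) hQ
    change _ = c at this
    rw [← this]
    exact esymmAlgHom_apply _
  rw [h3, mv_aeval]
  congr 2
  funext i
  exact eval_esymm z i

theorem restr_scale {k : Type*} [Field k] [IsAlgClosed k] {n : ℕ}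
    {F : MvPolynomial (Fin 6 ⊕ Fin 6) k} (hF : W n 0 F) (s : k) (hs : s ≠ 0) (z : Fin 4 → k) :
    ev F (xs (fun i => s * z i)) (ys k) = s ^ n * ev F (xs z) (ys k) := by
  obtain ⟨r, hr⟩ := IsAlgClosed.exists_pow_nat_eq s (n := 2) (by norm_num)
  have hr0 : r ≠ 0 := by rintro rfl; simp at hr; exact hs hr.symm
  have h1 := hF.sl2 r 0 0 r⁻¹ (by simp [hr0]) (xs z) (ys k)
  have h2 := hF.scale ![r⁻¹, r⁻¹, r, r, r, r] (fun i => r * xs z i + 0 * ys k i)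
    (fun i => 0 * xs z i + r⁻¹ * ys k i)
  have h3 : (∏ i, (![r⁻¹, r⁻¹, r, r, r, r] : Fin 6 → k) i) = s := by
    simp [Fin.prod_univ_succ]
    rw [← hr]; field_simp
  rw [h1, h3] at h2
  rw [← h2]
  congr 1
  · funext i
    fin_cases i <;> simp [xs, hr0, ← hr] <;> ring
  · funext i
    fin_cases i <;> simp [ys, hr0]

/-- the weight of an exponent vector -/
def wt (m : Fin 4 →₀ ℕ) : ℕ := m 0 + 2 * m 1 + 3 * m 2 + 4 * m 3

theorem restr_expand {k : Type*} [Field k] [IsAlgClosed k] {n : ℕ}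
    {F : MvPolynomial (Fin 6 ⊕ Fin 6) k} (hF : W n 0 F) :
    ∃ Q : MvPolynomial (Fin 4) k, ∀ z, ev F (xs z) (ys k) =
      ∑ m ∈ Q.support, if wt m = n then coeff m Q *
        (es z 0 ^ m 0 * es z 1 ^ m 1 * es z 2 ^ m 2 * es z 3 ^ m 3) else 0 := by
  obtain ⟨Q, hQ⟩ := restr_sym hF
  refine ⟨Q, fun z => ?_⟩
  have key : (∑ m ∈ Q.support, Polynomial.C (coeff m Q *
      (es z 0 ^ m 0 * es z 1 ^ m 1 * es z 2 ^ m 2 * es z 3 ^ m 3)) * Polynomial.X ^ (wt m)) =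
      Polynomial.C (ev F (xs z) (ys k)) * Polynomial.X ^ n := by
    rw [← sub_eq_zero]
    apply Polynomial.eq_zero_of_infinite_isRoot
    apply Set.Infinite.mono (s := ({0}ᶜ : Set k))
    · intro s hs
      change Polynomial.eval s _ = 0
      rw [Polynomial.eval_sub, sub_eq_zero, Polynomial.eval_finsetSum]
      simp only [Polynomial.eval_mul, Polynomial.eval_C, Polynomial.eval_pow, Polynomial.eval_X]
      rw [mul_comm (ev F _ _), ← restr_scale hF s hs, hQ, eval_eq']
      refine Finset.sum_congr rfl fun m _ => ?_
      rw [mul_assoc]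
      congr 1
      simp only [Fin.prod_univ_four, es_scale, wt, show ((0 : Fin 4) : ℕ) = 0 from rfl,
        show ((1 : Fin 4) : ℕ) = 1 from rfl, show ((2 : Fin 4) : ℕ) = 2 from rfl,
        show ((3 : Fin 4) : ℕ) = 3 from rfl]
      ring
    · exact (Set.finite_singleton (0:k)).infinite_compl
  have := congrArg (fun p => Polynomial.coeff p n) key
  simp only [Polynomial.finsetSum_coeff, Polynomial.coeff_C_mul, Polynomial.coeff_X_pow] at this
  rw [if_true, mul_one] at this
  rw [← this]
  refine Finset.sum_congr rfl fun m _ => ?_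
  by_cases h : wt m = n
  · simp [h]
  · simp [h, Ne.symm h]
end

open MvPolynomial
noncomputable section

/-- the hypotheses on the basic invariants -/
structure Basic {k : Type*} [Field k] (P2 P4 P6 P10 : MvPolynomial (Fin 7) k) : Prop where
  hh2 : P2.IsHomogeneous 2
  hh4 : P4.IsHomogeneous 4
  hh6 : P6.IsHomogeneous 6
  hh10 : P10.IsHomogeneous 10
  hi2 : SL2Invariant k 6 P2
  hi4 : SL2Invariant k 6 P4
  hi6 : SL2Invariant k 6 P6
  hi10 : SL2Invariant k 6 P10
  he2 : ∀ x y : Fin 6 → k, eval (sexticCoeff x y) P2 = I2r x y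
  he4 : ∀ x y : Fin 6 → k, eval (sexticCoeff x y) P4 = I4r x y
  he6 : ∀ x y : Fin 6 → k, eval (sexticCoeff x y) P6 = I6r x y
  he10 : ∀ x y : Fin 6 → k, eval (sexticCoeff x y) P10 = I10r x y

/-- homogeneous invariants of degree `n` inside a subalgebra -/
def HI {k : Type*} [Field k] (A : Subalgebra k (MvPolynomial (Fin 7) k)) (n : ℕ)
    (P : MvPolynomial (Fin 7) k) : Prop :=
  P.IsHomogeneous n ∧ P ∈ Rd k 6 ∧ P ∈ A

theorem HI.mul {k : Type*} [Field k] {A : Subalgebra k (MvPolynomial (Fin 7) k)} {n m : ℕ}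
    {P Q : MvPolynomial (Fin 7) k} (hP : HI A n P) (hQ : HI A m Q) : HI A (n + m) (P * Q) :=
  ⟨hP.1.mul hQ.1, mul_mem hP.2.1 hQ.2.1, mul_mem hP.2.2 hQ.2.2⟩

theorem HI.pow {k : Type*} [Field k] {A : Subalgebra k (MvPolynomial (Fin 7) k)} {n : ℕ}
    {P : MvPolynomial (Fin 7) k} (hP : HI A n P) (m : ℕ) : HI A (n * m) (P ^ m) :=
  ⟨hP.1.pow m, pow_mem hP.2.1 m, pow_mem hP.2.2 m⟩

theorem HI.sub {k : Type*} [Field k] {A : Subalgebra k (MvPolynomial (Fin 7) k)} {n : ℕ}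
    {P Q : MvPolynomial (Fin 7) k} (hP : HI A n P) (hQ : HI A n Q) : HI A n (P - Q) :=
  ⟨hP.1.sub hQ.1, sub_mem hP.2.1 hQ.2.1, sub_mem hP.2.2 hQ.2.2⟩

theorem HI.C {k : Type*} [Field k] (A : Subalgebra k (MvPolynomial (Fin 7) k)) (c : k) :
    HI A 0 (C c) :=
  ⟨isHomogeneous_C _ _, (Rd k 6).algebraMap_mem c, A.algebraMap_mem c⟩

theorem HI.sum {k : Type*} [Field k] {A : Subalgebra k (MvPolynomial (Fin 7) k)} {n : ℕ}
    {ι : Type*} (s : Finset ι) (P : ι → MvPolynomial (Fin 7) k) (h : ∀ i ∈ s, HI A n (P i)) :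
    HI A n (∑ i ∈ s, P i) :=
  ⟨IsHomogeneous.sum _ _ _ fun i hi => (h i hi).1, sum_mem fun i hi => (h i hi).2.1,
    sum_mem fun i hi => (h i hi).2.2⟩

theorem HI.smul {k : Type*} [Field k] {A : Subalgebra k (MvPolynomial (Fin 7) k)} {n : ℕ}
    {P : MvPolynomial (Fin 7) k} (c : k) (hP : HI A n P) : HI A n (MvPolynomial.C c * P) := by
  have := (HI.C A c).mul hP
  rwa [zero_add] at this

theorem exists_J {k : Type*} [Field k] {P2 P4 P6 P10 : MvPolynomial (Fin 7) k}
    (h2 : (2 : k) ≠ 0) (h3 : (3 : k) ≠ 0) (h5 : (5 : k) ≠ 0)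
    (hB : Basic P2 P4 P6 P10) (A : Subalgebra k (MvPolynomial (Fin 7) k))
    (hA : A = Algebra.adjoin k {P2, P4, P6, P10}) :
    ∃ J2 J4 J6, HI A 2 J2 ∧ HI A 4 J4 ∧ HI A 6 J6 ∧ ∀ z : Fin 4 → k, es z 0 = 0 →
      eval (sexticCoeff (xs z) (ys k)) J2 = es z 1 ∧
      eval (sexticCoeff (xs z) (ys k)) J6 = es z 2 ^ 2 ∧
      eval (sexticCoeff (xs z) (ys k)) J4 = es z 3 := by
  have m2 : HI A 2 P2 := ⟨hB.hh2, hB.hi2, by rw [hA]; exact Algebra.subset_adjoin (by simp)⟩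
  have m4 : HI A 4 P4 := ⟨hB.hh4, hB.hi4, by rw [hA]; exact Algebra.subset_adjoin (by simp)⟩
  have m6 : HI A 6 P6 := ⟨hB.hh6, hB.hi6, by rw [hA]; exact Algebra.subset_adjoin (by simp)⟩
  have mJ2 : HI A 2 (C (1/8) * P2) := m2.smul _
  have mJ4 : HI A 4 (C (1/3840) * (C 4 * P2 ^ 2 - P4)) := (((m2.pow 2).smul _).sub m4).smul _
  have mJ6 : HI A 6 (C (1/100) * (C (13/108) * P2 ^ 3 - C (1/108) * (P2 * P4) - P6)
      - C (2/3) * (C (1/8) * P2) ^ 3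
      - C (40/9) * ((C (1/8) * P2) * (C (1/3840) * (C 4 * P2 ^ 2 - P4)))) :=
    ((((((m2.pow 3).smul _).sub ((m2.mul m4).smul _)).sub m6).smul _).sub
      ((mJ2.pow 3).smul _)).sub ((mJ2.mul mJ4).smul _)
  refine ⟨_, _, _, mJ2, mJ4, mJ6, ?_⟩
  intro z hz
  obtain ⟨r1, r2, r3⟩ := restr_values h2 h3 h5 (xs z) (ys k) rfl rfl rfl rfl ⟨rfl, rfl, rfl, rfl⟩ hz
  refine ⟨?_, ?_, ?_⟩
  · change _ = _ at r1
    simp only [map_mul, eval_C, hB.he2]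
    change _ = (xs z 2 * xs z 3 + xs z 2 * xs z 4 + xs z 3 * xs z 4 +
      xs z 5 * (xs z 2 + xs z 3 + xs z 4))
    rw [r1]; ring
  · simp only [map_mul, map_sub, map_pow, eval_C, hB.he2, hB.he4, hB.he6]
    change _ = (xs z 2 * xs z 3 * xs z 4 + xs z 5 * (xs z 2 * xs z 3 + xs z 2 * xs z 4 +
      xs z 3 * xs z 4)) ^ 2
    rw [r3]; ring
  · simp only [map_mul, map_sub, map_pow, eval_C, hB.he2, hB.he4]
    change _ = xs z 2 * xs z 3 * xs z 4 * xs z 5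
    rw [r2]; ring

theorem approx {k : Type*} [Field k] [IsAlgClosed k] {P2 P4 P6 P10 : MvPolynomial (Fin 7) k}
    (h2 : (2 : k) ≠ 0) (h3 : (3 : k) ≠ 0) (h5 : (5 : k) ≠ 0)
    (hB : Basic P2 P4 P6 P10) (A : Subalgebra k (MvPolynomial (Fin 7) k))
    (hA : A = Algebra.adjoin k {P2, P4, P6, P10}) {n : ℕ} (hn : Even n)
    {F : MvPolynomial (Fin 6 ⊕ Fin 6) k} (hF : W n 0 F) :
    ∃ Φ, HI A n Φ ∧ ∀ z : Fin 4 → k, es z 0 = 0 → ev (pull Φ) (xs z) (ys k) =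
      ev F (xs z) (ys k) := by
  obtain ⟨J2, J4, J6, hJ2, hJ4, hJ6, hJ⟩ := exists_J h2 h3 h5 hB A hA
  obtain ⟨Q, hQ⟩ := restr_expand hF
  refine ⟨∑ m ∈ Q.support, if wt m = n ∧ m 0 = 0 then
    C (coeff m Q) * (J2 ^ m 1 * J6 ^ (m 2 / 2) * J4 ^ m 3) else 0, ?_, ?_⟩
  · apply HI.sum
    intro m _
    split_ifs with h
    · apply HI.smul
      have := ((hJ2.pow (m 1)).mul (hJ6.pow (m 2 / 2))).mul (hJ4.pow (m 3))
      have e : 2 * m 1 + 6 * (m 2 / 2) + 4 * m 3 = n := by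
        unfold wt at h
        obtain ⟨r, hr⟩ := hn
        omega
      rwa [e] at this
    · exact ⟨isHomogeneous_zero _ _ _, zero_mem _, zero_mem _⟩
  · intro z hz
    obtain ⟨e1, e2, e3⟩ := hJ z hz
    rw [ev_pull, hQ, map_sum]
    refine Finset.sum_congr rfl fun m _ => ?_
    by_cases hw : wt m = n
    · by_cases h0 : m 0 = 0
      · rw [if_pos ⟨hw, h0⟩, if_pos hw]
        simp only [map_mul, map_pow, eval_C, e1, e2, e3, h0, pow_zero, one_mul]
        rw [← pow_mul]
        have : 2 * (m 2 / 2) = m 2 := by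
          unfold wt at hw
          obtain ⟨r, hr⟩ := hn
          omega
        rw [this]
      · rw [if_neg (fun h => h0 h.2), if_pos hw, hz, zero_pow h0]
        simp
    · rw [if_neg (fun h => hw h.1), if_neg hw, map_zero]

theorem main_even {k : Type*} [Field k] [IsAlgClosed k] {P2 P4 P6 P10 : MvPolynomial (Fin 7) k}
    (h2 : (2 : k) ≠ 0) (h3 : (3 : k) ≠ 0) (h5 : (5 : k) ≠ 0)
    (hB : Basic P2 P4 P6 P10) (A : Subalgebra k (MvPolynomial (Fin 7) k))
    (hA : A = Algebra.adjoin k {P2, P4, P6, P10}) (n : ℕ) : Even n →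
    ∀ F : MvPolynomial (Fin 6 ⊕ Fin 6) k, W n 0 F → ∃ Φ ∈ A, F = pull Φ := by
  induction n using Nat.strong_induction_on with
  | _ n ih =>
    intro hn F hF
    obtain ⟨Φ, hΦ, hz⟩ := approx h2 h3 h5 hB A hA hn hF
    have hW : W n 0 (F - pull Φ) := W_sub hF (W_pull n Φ hΦ.1 hΦ.2.1)
    by_cases h0 : F - pull Φ = 0
    · exact ⟨Φ, hΦ.2.2, sub_eq_zero.1 h0⟩
    · obtain ⟨h10, G, hG, hFG⟩ := disc_dvd h2 hW h0 (by
        intro x x0 x1 hx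
        have e : x = xs ![x 2, x 3, x 4, x 5] := by
          funext i
          fin_cases i <;> simp [xs, x0, x1]
        rw [e, ev_sub, sub_eq_zero]
        exact (hz ![x 2, x 3, x 4, x 5] hx).symm)
      obtain ⟨Ψ, hΨ, hGΨ⟩ := ih (n - 10) (by omega) (by
        obtain ⟨r, hr⟩ := hn
        exact ⟨r - 5, by omega⟩) G hG
      refine ⟨Φ + P10 * Ψ, add_mem hΦ.2.2 (mul_mem (by
        rw [hA]; exact Algebra.subset_adjoin (by simp)) hΨ), ?_⟩
      apply ev_ext
      intro x y
      have := congrArg (fun p => ev p x y) hFG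
      simp only [ev_sub, ev_mul] at this
      rw [hGΨ] at this
      rw [ev_pull, map_add, map_mul, hB.he10, I10r_eq, ← ev_pull, ← ev_pull]
      linear_combination this

theorem even_mem {k : Type*} [Field k] [IsAlgClosed k] {P2 P4 P6 P10 : MvPolynomial (Fin 7) k}
    (h2 : (2 : k) ≠ 0) (h3 : (3 : k) ≠ 0) (h5 : (5 : k) ≠ 0)
    (hB : Basic P2 P4 P6 P10) (n : ℕ) (hn : Even n) (P : MvPolynomial (Fin 7) k)
    (hP : P.IsHomogeneous n) (hi : SL2Invariant k 6 P) :
    P ∈ Algebra.adjoin k {P2, P4, P6, P10} := by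
  obtain ⟨Φ, hΦ, h⟩ := main_even h2 h3 h5 hB _ rfl n hn (pull P) (W_pull n P hP hi)
  have : P = Φ := by
    apply MvPolynomial.funext
    intro a
    obtain ⟨x, y, rfl⟩ := sextic_surj a
    rw [← ev_pull, ← ev_pull, h]
  rw [this]; exact hΦ
end

open MvPolynomial
noncomputable section

theorem null_zero {k : Type*} [Field k] {n e : ℕ} {F : MvPolynomial (Fin 6 ⊕ Fin 6) k}
    (hF : W n e F) (hn : 0 < n) (x y : Fin 6 → k) (i : Fin 6) (hx : x i = 0) (hy : y i = 0) :
    ev F x y = 0 := by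
  have h := hF.scale (fun j => if j = i then 0 else 1) x y
  have h0 : (∏ j : Fin 6, (if j = i then (0 : k) else 1)) = 0 :=
    Finset.prod_eq_zero (Finset.mem_univ i) (by simp)
  rw [h0, zero_pow (by omega), zero_mul] at h
  rw [← h]
  congr 1
  · funext j
    by_cases hj : j = i
    · subst hj; simp [hx]
    · simp [hj]
  · funext j
    by_cases hj : j = i
    · subst hj; simp [hy]
    · simp [hj]

theorem two_more {k : Type*} [Field k] (h2 : (2 : k) ≠ 0) (h3 : (3 : k) ≠ 0) (x y : Fin 6 → k)
    (hx0 : x 0 = 1) (hx1 : x 1 = 1) (hy0 : y 0 = 0) (hy1 : y 1 = 0)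
    (hs : I2r x y = 0) (hnz : ∀ i, x i = 0 → y i = 0 → False)
    (hy : y 2 = 0 ∨ y 3 = 0 ∨ y 4 = 0 ∨ y 5 = 0) :
    (y 2 = 0 ∧ y 3 = 0) ∨ (y 2 = 0 ∧ y 4 = 0) ∨ (y 2 = 0 ∧ y 5 = 0) ∨ (y 3 = 0 ∧ y 4 = 0) ∨
    (y 3 = 0 ∧ y 5 = 0) ∨ (y 4 = 0 ∧ y 5 = 0) := by
  have hA : sumPairs x y = 0 := by
    unfold I2r at hs
    simpa [h2] using hs
  rw [sumPairs_double h2 h3 x y hx0 hx1 hy0 hy1] at hA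
  simp only [Dij] at hA
  have h6 : (6 : k) ≠ 0 := by
    have : (6 : k) = 2 * 3 := by norm_num
    rw [this]; exact mul_ne_zero h2 h3
  rcases hy with h | h | h | h
  · have := hnz 2
    have e : 6 * (x 2 * y 3 * y 4 * y 5) ^ 2 = 0 := by
      rw [h] at hA; linear_combination hA
    simp [h6] at e
    tauto
  · have := hnz 3
    have e : 6 * (x 3 * y 2 * y 4 * y 5) ^ 2 = 0 := by
      rw [h] at hA; linear_combination hA
    simp [h6] at e
    tauto
  · have := hnz 4
    have e : 6 * (x 4 * y 2 * y 3 * y 5) ^ 2 = 0 := by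
      rw [h] at hA; linear_combination hA
    simp [h6] at e
    tauto
  · have := hnz 5
    have e : 6 * (x 5 * y 2 * y 3 * y 4) ^ 2 = 0 := by
      rw [h] at hA; linear_combination hA
    simp [h6] at e
    tauto

theorem all_zero {k : Type*} [Field k] (a b c d : k) (e1 : a + b + c + d = 0)
    (e2 : a * b + a * c + b * c + d * (a + b + c) = 0)
    (e3 : (a * b * c + d * (a * b + a * c + b * c)) ^ 2 = 0)
    (e4 : a * b * c * d = 0) : a = 0 ∧ b = 0 ∧ c = 0 ∧ d = 0 := by
  have e3' := pow_eq_zero_iff (two_ne_zero) |>.1 e3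
  have key : ∀ z, (z - a) * (z - b) * (z - c) * (z - d) = 0 → z = 0 := by
    intro z hz
    have : z ^ 4 = 0 := by
      linear_combination hz + z ^ 3 * e1 - z ^ 2 * e2 + z * e3' - e4
    exact pow_eq_zero_iff (by norm_num) |>.1 this
  exact ⟨key a (by ring), key b (by ring), key c (by ring), key d (by ring)⟩

theorem null01 {k : Type*} [Field k] [Infinite k] {P2 P4 P6 P10 : MvPolynomial (Fin 7) k}
    (h2 : (2 : k) ≠ 0) (h3 : (3 : k) ≠ 0) (h5 : (5 : k) ≠ 0)
    (hB : Basic P2 P4 P6 P10) {n : ℕ} (hn : 0 < n) {F : MvPolynomial (Fin 6 ⊕ Fin 6) k}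
    (hF : W n 0 F) (x y : Fin 6 → k) (hD : Dij x y 0 1 = 0)
    (h0 : x 0 ≠ 0 ∨ y 0 ≠ 0) (h1 : x 1 ≠ 0 ∨ y 1 ≠ 0)
    (p2 : ev (pull P2) x y = 0) (p4 : ev (pull P4) x y = 0) (p6 : ev (pull P6) x y = 0) :
    ev F x y = 0 := by
  have W2 := W_pull 2 P2 hB.hh2 hB.hi2
  have W4 := W_pull 4 P4 hB.hh4 hB.hi4
  have W6 := W_pull 6 P6 hB.hh6 hB.hi6
  obtain ⟨x', y', T, hT, hW, a0, a1, b0, b1, -⟩ := std_form x y hD h0 h1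
  have q2 : ev (pull P2) x' y' = 0 := by rw [hW _ _ _ W2, p2, mul_zero]
  have q4 : ev (pull P4) x' y' = 0 := by rw [hW _ _ _ W4, p4, mul_zero]
  have q6 : ev (pull P6) x' y' = 0 := by rw [hW _ _ _ W6, p6, mul_zero]
  suffices h : ev F x' y' = 0 by
    rw [hW _ _ _ hF] at h
    simpa [hT] using h
  by_cases hz : ∃ i, x' i = 0 ∧ y' i = 0
  · obtain ⟨i, e1, e2⟩ := hz
    exact null_zero hF hn x' y' i e1 e2
  by_cases hy : y' 2 = 0 ∨ y' 3 = 0 ∨ y' 4 = 0 ∨ y' 5 = 0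
  · rw [ev_pull, hB.he2] at q2
    have := two_more h2 h3 x' y' a0 a1 b0 b1 q2 (fun i e1 e2 => hz ⟨i, e1, e2⟩) hy
    have fin : ∀ a b : Fin 6, a ≠ b → (∀ i, i = a ∨ i = b ∨ y' i = 0) → ev F x' y' = 0 := by
      intro a b hab h
      apply null_W hF hn x' y' a b hab
      intro i hia hib
      exact ((h i).resolve_left hia).resolve_left hib
    have all : ∀ p : Fin 6 → Prop, p 0 → p 1 → p 2 → p 3 → p 4 → p 5 → ∀ i, p i := by
      intro p _ _ _ _ _ _ i
      fin_cases i
      all_goals assumption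
    rcases this with h | h | h | h | h | h
    · exact fin 4 5 (by decide) (all _ (by simp [b0]) (by simp [b1]) (by simp [h]) (by simp [h])
        (by simp) (by simp))
    · exact fin 3 5 (by decide) (all _ (by simp [b0]) (by simp [b1]) (by simp [h]) (by simp)
        (by simp [h]) (by simp))
    · exact fin 3 4 (by decide) (all _ (by simp [b0]) (by simp [b1]) (by simp [h]) (by simp)
        (by simp) (by simp [h]))
    · exact fin 2 5 (by decide) (all _ (by simp [b0]) (by simp [b1]) (by simp) (by simp [h])
        (by simp [h]) (by simp))
    · exact fin 2 4 (by decide) (all _ (by simp [b0]) (by simp [b1]) (by simp) (by simp [h])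
        (by simp) (by simp [h]))
    · exact fin 2 3 (by decide) (all _ (by simp [b0]) (by simp [b1]) (by simp) (by simp)
        (by simp [h]) (by simp [h]))
  · have hy' : y' 2 ≠ 0 ∧ y' 3 ≠ 0 ∧ y' 4 ≠ 0 ∧ y' 5 ≠ 0 := by
      simpa only [not_or] using hy
    obtain ⟨x'', T', c, hT', hW', a0', a1', hsum⟩ := spec_form h2 x' y' a0 a1 b0 b1 hy'
    have r2 : ev (pull P2) x'' (ys k) = 0 := by rw [hW' _ _ _ W2, q2, mul_zero]
    have r4 : ev (pull P4) x'' (ys k) = 0 := by rw [hW' _ _ _ W4, q4, mul_zero]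
    have r6 : ev (pull P6) x'' (ys k) = 0 := by rw [hW' _ _ _ W6, q6, mul_zero]
    rw [ev_pull, hB.he2] at r2
    rw [ev_pull, hB.he4] at r4
    rw [ev_pull, hB.he6] at r6
    obtain ⟨s2, s4, s6⟩ := restr_values h2 h3 h5 x'' (ys k) a0' a1' rfl rfl ⟨rfl, rfl, rfl, rfl⟩ hsum
    rw [r2, r4, r6] at s6
    rw [r2, r4] at s4
    rw [r2] at s2
    obtain ⟨z2, z3, z4, z5⟩ := all_zero (x'' 2) (x'' 3) (x'' 4) (x'' 5) hsum
      (by rw [s2]; simp) (by rw [s6]; simp) (by rw [s4]; simp)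
    suffices h : ev F x'' (ys k) = 0 by
      rw [hW' _ _ _ hF] at h
      simpa [hT'] using h
    rw [← hF.sl2 0 1 (-1) 0 (by ring)]
    apply null_W hF hn _ _ 0 1 (by decide)
    intro i hi0 hi1
    fin_cases i <;> simp_all

theorem null_all {k : Type*} [Field k] [Infinite k] {P2 P4 P6 P10 : MvPolynomial (Fin 7) k}
    (h2 : (2 : k) ≠ 0) (h3 : (3 : k) ≠ 0) (h5 : (5 : k) ≠ 0)
    (hB : Basic P2 P4 P6 P10) {n : ℕ} (hn : 0 < n) {F : MvPolynomial (Fin 6 ⊕ Fin 6) k}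
    (hF : W n 0 F) (x y : Fin 6 → k)
    (p2 : ev (pull P2) x y = 0) (p4 : ev (pull P4) x y = 0) (p6 : ev (pull P6) x y = 0)
    (p10 : ev (pull P10) x y = 0) : ev F x y = 0 := by
  by_cases hz : ∃ i, x i = 0 ∧ y i = 0
  · obtain ⟨i, e1, e2⟩ := hz
    exact null_zero hF hn x y i e1 e2
  have hnz : ∀ i, x i ≠ 0 ∨ y i ≠ 0 := by
    intro i
    by_contra! h
    exact hz ⟨i, h⟩
  rw [ev_pull, hB.he10, I10r_eq] at p10
  have p10' := pow_eq_zero_iff (two_ne_zero) |>.1 p10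
  rw [ev_Del, Finset.prod_eq_zero_iff] at p10'
  obtain ⟨⟨i, j⟩, hij, hD⟩ := p10'
  simp only [prs, Finset.mem_filter, Finset.mem_univ, true_and] at hij
  obtain ⟨σ, s0, s1⟩ := exists_perm01 i j hij.ne
  have hs : ∀ (m : ℕ) (G : MvPolynomial (Fin 6 ⊕ Fin 6) k), W m 0 G →
      ev G (fun i => x (σ i)) (fun i => y (σ i)) = ev G x y := by
    intro m G hG
    rw [hG.sym, pow_zero, one_mul]
  rw [← hs n F hF]
  apply null01 h2 h3 h5 hB hn hF
  · simp only [Dij] at hD ⊢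
    rw [s0, s1]; exact hD
  · exact hnz _
  · exact hnz _
  · rw [hs _ _ (W_pull 2 P2 hB.hh2 hB.hi2), p2]
  · rw [hs _ _ (W_pull 4 P4 hB.hh4 hB.hi4), p4]
  · rw [hs _ _ (W_pull 6 P6 hB.hh6 hB.hi6), p6]

theorem null_cone_eq {k : Type*} [Field k] [IsAlgClosed k] {P2 P4 P6 P10 : MvPolynomial (Fin 7) k}
    (h2 : (2 : k) ≠ 0) (h3 : (3 : k) ≠ 0) (h5 : (5 : k) ≠ 0) (hB : Basic P2 P4 P6 P10) :
    nullCone k 6 =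
      {a : Fin 7 → k | eval a P2 = 0 ∧ eval a P4 = 0 ∧ eval a P6 = 0 ∧ eval a P10 = 0} := by
  ext a
  constructor
  · intro h
    exact ⟨h 2 P2 hB.hi2 hB.hh2 (by norm_num), h 4 P4 hB.hi4 hB.hh4 (by norm_num),
      h 6 P6 hB.hi6 hB.hh6 (by norm_num), h 10 P10 hB.hi10 hB.hh10 (by norm_num)⟩
  · rintro ⟨e2, e4, e6, e10⟩ n P hi hP hn
    obtain ⟨x, y, rfl⟩ := sextic_surj a
    rw [← ev_pull] at *
    exact null_all h2 h3 h5 hB hn (W_pull n P hP hi) x y e2 e4 e6 e10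
end

open MvPolynomial
noncomputable section

theorem actCoeff_smul {k : Type*} [Field k] (d : ℕ) (g : Matrix (Fin 2) (Fin 2) k) (s : k)
    (a : Fin (d+1) → k) :
    actCoeff k d g (fun i => s * a i) = fun i => s * actCoeff k d g a i := by
  have h1 : toForm k d (fun i => s * a i) = C s * toForm k d a := by
    unfold toForm
    rw [Finset.mul_sum]
    refine Finset.sum_congr rfl fun i _ => ?_
    rw [C_mul]; ring
  funext i
  unfold actCoeff
  rw [h1]
  unfold matAct formCoeff
  rw [map_mul, aeval_C, algebraMap_eq, coeff_C_mul]

theorem eval_scale_poly {k : Type*} [Field k] {σ : Type*} (P : MvPolynomial σ k) (a : σ → k) (s : k) :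
    eval (fun i => s * a i) P = ∑ i ∈ Finset.range (P.totalDegree + 1),
      eval a (homogeneousComponent i P) * s ^ i := by
  conv_lhs => rw [← sum_homogeneousComponent P]
  rw [map_sum]
  refine Finset.sum_congr rfl fun i _ => ?_
  rw [hom_smul _ i (homogeneousComponent_isHomogeneous i P)]
  ring

theorem comp_invariant {k : Type*} [Field k] [Infinite k] (P : MvPolynomial (Fin 7) k)
    (hP : SL2Invariant k 6 P) (n : ℕ) : SL2Invariant k 6 (homogeneousComponent n P) := by
  by_cases hn : n < P.totalDegree + 1
  · intro g a
    have key : (∑ i ∈ Finset.range (P.totalDegree + 1),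
        Polynomial.C (eval (actCoeff k 6 (g : Matrix (Fin 2) (Fin 2) k) a)
          (homogeneousComponent i P)) * Polynomial.X ^ i) =
        ∑ i ∈ Finset.range (P.totalDegree + 1),
        Polynomial.C (eval a (homogeneousComponent i P)) * Polynomial.X ^ i := by
      apply Polynomial.funext
      intro s
      simp only [Polynomial.eval_finsetSum, Polynomial.eval_mul, Polynomial.eval_C,
        Polynomial.eval_pow, Polynomial.eval_X]
      rw [← eval_scale_poly, ← eval_scale_poly, ← actCoeff_smul]
      exact hP g _
    have := congrArg (fun p => Polynomial.coeff p n) key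
    simpa [Polynomial.finsetSum_coeff, Polynomial.coeff_X_pow, hn] using this
  · rw [homogeneousComponent_eq_zero _ _ (by omega)]
    intro g a
    simp

theorem module_finite {k : Type*} [Field k] [IsAlgClosed k] {P2 P4 P6 P10 : MvPolynomial (Fin 7) k}
    (h2 : (2 : k) ≠ 0) (h3 : (3 : k) ≠ 0) (h5 : (5 : k) ≠ 0) (hB : Basic P2 P4 P6 P10) :
    ∃ t : Finset (MvPolynomial (Fin 7) k),
      (↑t : Set (MvPolynomial (Fin 7) k)) ⊆ (Rd k 6 : Set (MvPolynomial (Fin 7) k)) ∧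
      ∀ P ∈ Rd k 6,
        P ∈ Submodule.span (Algebra.adjoin k {P2, P4, P6, P10})
          (↑t : Set (MvPolynomial (Fin 7) k)) := by
  classical
  have hev := even_mem h2 h3 h5 hB
  have hAR : Algebra.adjoin k {P2, P4, P6, P10} ≤ Rd k 6 := by
    apply Algebra.adjoin_le
    intro P hP
    simp only [Set.mem_insert_iff, Set.mem_singleton_iff] at hP
    rcases hP with rfl | rfl | rfl | rfl
    · exact hB.hi2
    · exact hB.hi4
    · exact hB.hi6
    · exact hB.hi10
  have hN : IsNoetherianRing (Algebra.adjoin k {P2, P4, P6, P10}) := by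
    have hfg : (Algebra.adjoin k ({P2, P4, P6, P10} : Set (MvPolynomial (Fin 7) k))).FG :=
      ⟨{P2, P4, P6, P10}, by simp⟩
    have := (Subalgebra.fg_iff_finiteType _).1 hfg
    exact Algebra.FiniteType.isNoetherianRing k _
  generalize Algebra.adjoin k {P2, P4, P6, P10} = A at *
  have hodd : ∃ t : Finset (MvPolynomial (Fin 7) k),
      (↑t : Set (MvPolynomial (Fin 7) k)) ⊆ (Rd k 6 : Set (MvPolynomial (Fin 7) k)) ∧
      ∀ n P, ¬ Even n → P.IsHomogeneous n → SL2Invariant k 6 P →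
        P ∈ Submodule.span A (↑t : Set (MvPolynomial (Fin 7) k)) := by
    by_cases hex : ∃ n P, ¬ Even n ∧ P.IsHomogeneous n ∧ SL2Invariant k 6 P ∧ P ≠ 0
    · obtain ⟨n0, P0, hn0, hP0, hi0, hne⟩ := hex
      let M : Submodule A (MvPolynomial (Fin 7) k) :=
        { carrier := {Q | Q ∈ Rd k 6 ∧ P0 * Q ∈ A}
          zero_mem' := ⟨zero_mem _, by rw [mul_zero]; exact zero_mem _⟩
          add_mem' := fun {a b} ha hb => ⟨add_mem ha.1 hb.1, by
            rw [mul_add]; exact add_mem ha.2 hb.2⟩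
          smul_mem' := fun c Q hQ => ⟨by
            rw [Subalgebra.smul_def, smul_eq_mul]
            exact mul_mem (hAR c.2) hQ.1, by
            rw [Subalgebra.smul_def, smul_eq_mul, mul_left_comm]
            exact mul_mem c.2 hQ.2⟩ }
      have hFG : M.FG := by
        apply Submodule.fg_of_fg_map_injective (LinearMap.mulLeft A P0)
        · intro a b hab
          exact mul_left_cancel₀ hne hab
        · have hs := isNoetherian_span_of_finite A
            (Set.finite_singleton (1 : MvPolynomial (Fin 7) k))
          rw [isNoetherian_submodule] at hs
          apply hs
          rintro _ ⟨Q, hQ, rfl⟩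
          rw [Submodule.mem_span_singleton]
          exact ⟨⟨P0 * Q, hQ.2⟩, by simp [Subalgebra.smul_def]⟩
      obtain ⟨t, ht⟩ := hFG
      refine ⟨t, ?_, ?_⟩
      · intro Q hQ
        have : Q ∈ M := by rw [← ht]; exact Submodule.subset_span hQ
        exact this.1
      · intro n P hn hP hi
        rw [ht]
        refine ⟨hi, hev (n0 + n) ?_ _ (hP0.mul hP) ((Rd k 6).mul_mem hi0 hi)⟩
        rw [Nat.even_add]; tauto
    · refine ⟨∅, by simp, ?_⟩
      intro n P hn hP hi
      have : P = 0 := by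
        by_contra h
        exact hex ⟨n, P, hn, hP, hi, h⟩
      rw [this]; exact zero_mem _
  obtain ⟨t, htR, ht⟩ := hodd
  refine ⟨insert 1 t, ?_, ?_⟩
  · intro Q hQ
    simp only [Finset.coe_insert, Set.mem_insert_iff] at hQ
    rcases hQ with rfl | hQ
    · exact one_mem _
    · exact htR hQ
  · intro P hP
    rw [← sum_homogeneousComponent P]
    apply sum_mem
    intro n _
    have hc := comp_invariant P hP n
    have hh := homogeneousComponent_isHomogeneous n P
    by_cases hn : Even n
    · have h1 : (1 : MvPolynomial (Fin 7) k) ∈ Submodule.span A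
          (↑(insert 1 t) : Set (MvPolynomial (Fin 7) k)) := Submodule.subset_span (by simp)
      have := Submodule.smul_mem _ (⟨homogeneousComponent n P, hev n hn _ hh hc⟩ : A) h1
      rw [Subalgebra.smul_def, smul_eq_mul, mul_one] at this
      exact this
    · exact Submodule.span_mono (by simp) (ht n _ hn hh hc)
end

/-- The null cone of binary sextics is the common zero set of `I₂, I₄, I₆, I₁₀`, and
consequently `R₆` is a finitely generated module over `k[I₂, I₄, I₆, I₁₀]`.
The invariants `I₂, I₄, I₆, I₁₀` are characterized as the homogeneous invariant
polynomials in the coefficients whose value on `∏ (yᵢX - xᵢY)` is given by the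
symmetric root expressions. -/
theorem null_cone_of_sextics_and_module_finiteness
    (k : Type*) [Field k] [IsAlgClosed k]
    (h2 : (2 : k) ≠ 0) (h3 : (3 : k) ≠ 0) (h5 : (5 : k) ≠ 0)
    (P2 P4 P6 P10 : MvPolynomial (Fin 7) k)
    (hh2 : P2.IsHomogeneous 2) (hh4 : P4.IsHomogeneous 4)
    (hh6 : P6.IsHomogeneous 6) (hh10 : P10.IsHomogeneous 10)
    (hi2 : SL2Invariant k 6 P2) (hi4 : SL2Invariant k 6 P4)
    (hi6 : SL2Invariant k 6 P6) (hi10 : SL2Invariant k 6 P10)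
    (he2 : ∀ x y : Fin 6 → k, eval (sexticCoeff x y) P2 = I2r x y)
    (he4 : ∀ x y : Fin 6 → k, eval (sexticCoeff x y) P4 = I4r x y)
    (he6 : ∀ x y : Fin 6 → k, eval (sexticCoeff x y) P6 = I6r x y)
    (he10 : ∀ x y : Fin 6 → k, eval (sexticCoeff x y) P10 = I10r x y) :
    nullCone k 6 =
      {a : Fin 7 → k | eval a P2 = 0 ∧ eval a P4 = 0 ∧ eval a P6 = 0 ∧ eval a P10 = 0}
    ∧ ∃ t : Finset (MvPolynomial (Fin 7) k),
      (↑t : Set (MvPolynomial (Fin 7) k)) ⊆ (Rd k 6 : Set (MvPolynomial (Fin 7) k)) ∧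
      ∀ P ∈ Rd k 6,
        P ∈ Submodule.span (Algebra.adjoin k {P2, P4, P6, P10})
          (↑t : Set (MvPolynomial (Fin 7) k)) := by
  have hB : Basic P2 P4 P6 P10 :=
    ⟨hh2, hh4, hh6, hh10, hi2, hi4, hi6, hi10, he2, he4, he6, he10⟩
  exact ⟨null_cone_eq h2 h3 h5 hB, module_finite h2 h3 h5 hB⟩
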